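/- Let P be a simple polygon, let Π be a connected curve contained in P that intersects every nonredundant cut of P, let C be a nonredundant cut of P with endpoints v_C and w_C, and let x be a vertex of Pocket(C) visible from part of C. With I_{L_x}, I_{R_x} the intersections with C of the extensions of the first segments of the shortest paths from x to v_C and to w_C, and C_{L_x}, C_{R_x} the associated cuts: if Π intersects the subsegment of C from I_{L_x} to I_{R_x}, or intersects the subsegment from v_C to I_{L_x}, or intersects the subsegment from I_{R_x} to w_C, then in each case x is visible from some point of Π (in the latter two cases because Π must intersect C_{L_x}, respectively C_{R_x}, and hence the extension of the segment x L_x, respectively x R_x). -/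

import Mathlib

open Set

noncomputable section

/-- The Euclidean plane. -/
abbrev E2 := EuclideanSpace ℝ (Fin 2)

/-- A simple polygon in the plane, given by its cyclic sequence of vertices.
Adjacent edges meet exactly at their common vertex, and non-adjacent edges
are disjoint, so the boundary is a simple closed polygonal curve. -/
structure SimplePolygon where
  n : ℕ
  three_le : 3 ≤ n
  vtx : ZMod n → E2
  inj : Function.Injective vtx
  adj_edges : ∀ i : ZMod n,
    segment ℝ (vtx i) (vtx (i + 1)) ∩ segment ℝ (vtx (i + 1)) (vtx (i + 2)) = {vtx (i + 1)}
  nonadj_edges : ∀ i j : ZMod n, i ≠ j → i + 1 ≠ j → j + 1 ≠ i →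
    segment ℝ (vtx i) (vtx (i + 1)) ∩ segment ℝ (vtx j) (vtx (j + 1)) = ∅

namespace SimplePolygon

variable (P : SimplePolygon)

/-- The boundary `∂P`: the union of the edges. -/
def boundary : Set E2 := ⋃ i : ZMod P.n, segment ℝ (P.vtx i) (P.vtx (i + 1))

/-- The compact region bounded by `∂P`: the boundary together with all points of the
bounded connected components of its complement. -/
def region : Set E2 :=
  P.boundary ∪ {x | x ∉ P.boundary ∧ Bornology.IsBounded (connectedComponentIn P.boundaryᶜ x)}

/-- `x` sees `y` (in `P`) if the closed segment `[x,y]` is contained in `P`. -/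
def Visible (x y : E2) : Prop := segment ℝ x y ⊆ P.region

/-- The vertex `vtx i` is reflex: its internal angle is strictly larger than `π`, i.e.
near the vertex the midpoint of two points at equal small parameter along the two
incident edges lies outside the region. -/
def IsReflex (i : ZMod P.n) : Prop :=
  ∃ ε₀ > (0 : ℝ), ∀ ε ∈ Set.Ioo (0 : ℝ) ε₀,
    midpoint ℝ (P.vtx i + ε • (P.vtx (i - 1) - P.vtx i))
               (P.vtx i + ε • (P.vtx (i + 1) - P.vtx i)) ∉ P.region

/-- `P` is star-shaped if a single point of `P` sees all of `P`. -/
def IsStarShaped : Prop := ∃ x ∈ P.region, ∀ y ∈ P.region, P.Visible x y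

/-- A visibility path: a connected curve inside `P` from which every point of `P`
is visible. -/
def IsVisibilityPath (Pth : Set E2) : Prop :=
  IsConnected Pth ∧ Pth ⊆ P.region ∧ ∀ x ∈ P.region, ∃ p ∈ Pth, P.Visible x p

/-- The pocket, inside `P`, determined by a cut segment `s` on the side of the point `u`:
the closure of the connected component of `P \ s` containing `u`, together with `s`. -/
def pocketOfSeg (s : Set E2) (u : E2) : Set E2 :=
  closure (connectedComponentIn (P.region \ s) u) ∪ s

end SimplePolygon

/-- A cut of a simple polygon `P`: for a reflex vertex `v = vtx i` with adjacent
vertex `u = vtx j`, the segment from `v` to the closest point `w` of `∂P` hit by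
the ray from `v` in the direction from `u` to `v`. -/
structure SimplePolygon.Cut (P : SimplePolygon) where
  i : ZMod P.n
  j : ZMod P.n
  adj : j = i + 1 ∨ j = i - 1
  reflex : P.IsReflex i
  t : ℝ
  t_pos : 0 < t
  hits : P.vtx i + t • (P.vtx i - P.vtx j) ∈ P.boundary
  first_hit : ∀ s ∈ Set.Ioo (0 : ℝ) t, P.vtx i + s • (P.vtx i - P.vtx j) ∉ P.boundary
  inside : segment ℝ (P.vtx i) (P.vtx i + t • (P.vtx i - P.vtx j)) ⊆ P.region

namespace SimplePolygon.Cut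

variable {P : SimplePolygon} (C : P.Cut)

/-- The reflex vertex generating the cut. -/
def v : E2 := P.vtx C.i

/-- The adjacent vertex `u`; the edge `u v` is the generator of the cut. -/
def u : E2 := P.vtx C.j

/-- The other endpoint of the cut, on `∂P`. -/
def w : E2 := P.vtx C.i + C.t • (P.vtx C.i - P.vtx C.j)

/-- The cut as a segment. -/
def seg : Set E2 := segment ℝ C.v C.w

/-- `Pocket(C)`: the part of `P` cut off by `C` that contains the generator vertex `u`. -/
def pocket : Set E2 := P.pocketOfSeg C.seg C.u

/-- A cut is redundant if the pocket of some cut is strictly contained in its pocket. -/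
def Redundant : Prop := ∃ C' : P.Cut, C'.pocket ⊂ C.pocket

/-- A nonredundant (essential) cut. -/
def Nonredundant : Prop := ¬ C.Redundant

/-- `x` is a vertex of the polygon `Pocket(C)`: either the endpoint `w` of the cut, or a
vertex of `P` belonging to the pocket. -/
def PocketVertex (x : E2) : Prop :=
  x = C.w ∨ ∃ k : ZMod P.n, P.vtx k = x ∧ x ∈ C.pocket

end SimplePolygon.Cut

/-- Length of a polygonal path given by its list of vertices. -/
def polyLength (l : List E2) : ℝ := ((l.zip l.tail).map fun p => dist p.1 p.2).sum

namespace SimplePolygon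

variable (P : SimplePolygon)

/-- A polygonal path inside `P`: a nonempty list of points with each consecutive
segment contained in `P`. -/
def IsPolyPathIn (l : List E2) : Prop :=
  l ≠ [] ∧ List.Chain' (fun a b => segment ℝ a b ⊆ P.region) l

/-- `l` is a shortest Euclidean (polygonal) path inside `P` from `x` to the set `S`. -/
def IsGeodesicTo (x : E2) (S : Set E2) (l : List E2) : Prop :=
  P.IsPolyPathIn l ∧ l.head? = some x ∧ (∃ y ∈ S, l.getLast? = some y) ∧
  ∀ m : List E2, P.IsPolyPathIn m → m.head? = some x →
    (∃ y ∈ S, m.getLast? = some y) → polyLength l ≤ polyLength m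

/-- The subpolygon `Q` of `P` obtained by cutting `P` along all nonredundant cuts:
the closure of `P` minus the union of the pockets of all nonredundant cuts. -/
def core : Set E2 :=
  closure (P.region \ ⋃ C : {C : P.Cut // C.Nonredundant}, (C : P.Cut).pocket)

end SimplePolygon

/-- The planar cross product. -/
def cross2 (a b : E2) : ℝ := a 0 * b 1 - a 1 * b 0

/-- A polygonal chain all of whose turns have the sign `s` (a convex chain bending
consistently to one side). -/
def ConvexChain (s : ℝ) (l : List E2) : Prop :=
  ∀ p q r : E2, [p, q, r] <:+: l → 0 ≤ s * cross2 (q - p) (r - q)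

/-! ### The planar cross product -/

lemma exists_smul_eq_of_cross2_eq_zero {a b : E2} (ha : a ≠ 0) (h : cross2 a b = 0) :
    ∃ t : ℝ, b = t • a := by
  by_cases h0 : a 0 = 0
  · have h1 : a 1 ≠ 0 := by
      intro h1
      apply ha
      ext i
      fin_cases i <;> simp [h0, h1]
    refine ⟨b 1 / a 1, ?_⟩
    ext i
    fin_cases i
    · have : a 1 * b 0 = 0 := by simp [cross2, h0] at h; simpa using h
      have : b 0 = 0 := by simpa [h1] using this
      simp [h0, this]
    · simp [h1]
  · refine ⟨b 0 / a 0, ?_⟩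
    ext i
    fin_cases i
    · simp [h0]
    · simp only [cross2] at h
      simp
      field_simp
      linarith

/-! ### Continuous logarithms on a planar set -/

/-- The identification of the Euclidean plane with the complex numbers. -/
def planeToComplex : E2 ≃ₗᵢ[ℝ] ℂ := Complex.orthonormalBasisOneI.repr.symm

lemma planeToComplex_re (z : E2) : (planeToComplex z).re = z 0 := by
  simp [planeToComplex, Complex.orthonormalBasisOneI_repr_symm_apply]

lemma planeToComplex_im (z : E2) : (planeToComplex z).im = z 1 := by
  simp [planeToComplex, Complex.orthonormalBasisOneI_repr_symm_apply]

/-- The function `z ↦ z - m` has a continuous logarithm on `R` away from `m`. -/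
def HasLogOn (R : Set E2) (m : E2) : Prop :=
  ∃ g : E2 → ℂ, ContinuousOn g (R \ {m}) ∧
    ∀ z ∈ R \ {m}, Complex.exp (g z) = planeToComplex (z - m)

lemma continuous_planeToComplex_sub (m : E2) : Continuous fun z : E2 => planeToComplex (z - m) :=
  planeToComplex.continuous.comp (continuous_id.sub continuous_const)

lemma planeToComplex_sub_ne_zero {z m : E2} (h : z ≠ m) : planeToComplex (z - m) ≠ 0 := by
  simpa [sub_eq_zero] using h

/-- A continuous logarithm at `m` is transported to `n` along a continuous branch of the logarithm
of the quotient. -/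
lemma HasLogOn.transfer {R : Set E2} {m n : E2} (hm : HasLogOn R m) (hmR : m ∉ R)
    (h : ∀ z ∈ R \ {n}, planeToComplex (z - n) / planeToComplex (z - m) ∈ Complex.slitPlane) :
    HasLogOn R n := by
  obtain ⟨g, hg, hexp⟩ := hm
  have hne : ∀ z ∈ R \ {n}, z ≠ m := fun z hz e => hmR (e ▸ hz.1)
  refine ⟨fun z => g z + Complex.log (planeToComplex (z - n) / planeToComplex (z - m)), ?_, ?_⟩
  · refine (hg.mono fun z hz => ⟨hz.1, hne z hz⟩).add (ContinuousOn.clog ?_ h)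
    exact (continuous_planeToComplex_sub n).continuousOn.div
      (continuous_planeToComplex_sub m).continuousOn
      fun z hz => planeToComplex_sub_ne_zero (hne z hz)
  · intro z hz
    have h1 := planeToComplex_sub_ne_zero (hne z hz)
    rw [Complex.exp_add, hexp z ⟨hz.1, hne z hz⟩, Complex.exp_log (Complex.slitPlane_ne_zero (h z hz))]
    field_simp

lemma HasLogOn.of_norm_lt {R : Set E2} {m n : E2} (hm : HasLogOn R m)
    (h : ∀ z ∈ R, ‖n - m‖ < ‖z - m‖) : HasLogOn R n := by
  have hmR : m ∉ R := fun hR => by simpa using (norm_nonneg (n - m)).trans_lt (h m hR)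
  refine hm.transfer hmR fun z hz => Complex.ball_one_subset_slitPlane ?_
  have hzm : z ≠ m := fun e => hmR (e ▸ hz.1)
  have h1 := planeToComplex_sub_ne_zero hzm
  have : planeToComplex (z - n) / planeToComplex (z - m) - 1
      = planeToComplex (m - n) / planeToComplex (z - m) := by
    rw [div_sub_one h1, ← map_sub]
    congr 2
    abel
  rw [mem_ball_iff_norm, this, norm_div, LinearIsometryEquiv.norm_map,
    LinearIsometryEquiv.norm_map, norm_sub_rev m n, div_lt_one (by simpa [sub_eq_zero] using hzm)]
  exact h z hz.1

lemma hasLogOn_of_norm_lt {R : Set E2} {m : E2} (h : ∀ z ∈ R, ‖z‖ < ‖m‖) : HasLogOn R m := by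
  rcases R.eq_empty_or_nonempty with rfl | ⟨z₀, hz₀⟩
  · exact ⟨fun _ => 0, by simp, by simp⟩
  have hm : planeToComplex m ≠ 0 := by
    have := (norm_nonneg z₀).trans_lt (h z₀ hz₀)
    simpa using this
  have key : ∀ z ∈ R, planeToComplex (z - m) / (-planeToComplex m) ∈ Complex.slitPlane := by
    intro z hz
    apply Complex.ball_one_subset_slitPlane
    have : planeToComplex (z - m) / (-planeToComplex m) - 1 = -(planeToComplex z / planeToComplex m) := by
      rw [map_sub]; field_simp; ring
    rw [mem_ball_iff_norm, this, norm_neg, norm_div, LinearIsometryEquiv.norm_map,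
      LinearIsometryEquiv.norm_map, div_lt_one (by simpa using hm)]
    exact h z hz
  refine ⟨fun z => Complex.log (planeToComplex (z - m) / (-planeToComplex m))
    + Complex.log (-planeToComplex m), ?_, ?_⟩
  · refine (ContinuousOn.clog ?_ fun z hz => key z hz.1).add continuousOn_const
    exact (continuous_planeToComplex_sub m).continuousOn.div_const _
  · intro z hz
    rw [Complex.exp_add, Complex.exp_log (Complex.slitPlane_ne_zero (key z hz.1)),
      Complex.exp_log (neg_ne_zero.2 hm), div_mul_cancel₀ _ (neg_ne_zero.2 hm)]

lemma hasLogOn_iff_of_isPreconnected {R U : Set E2} (hR : IsClosed R) (hU : IsPreconnected U)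
    (hUR : Disjoint U R) {m n : E2} (hm : m ∈ U) (hn : n ∈ U) (h : HasLogOn R m) :
    HasLogOn R n := by
  have hloc : ∀ a ∈ U, ∃ r > 0, ∀ b ∈ Metric.ball a r, (HasLogOn R a ↔ HasLogOn R b) := by
    intro a ha
    have haR : a ∈ Rᶜ := fun h' => hUR.le_bot ⟨ha, h'⟩
    obtain ⟨r, hr, hball⟩ := Metric.isOpen_iff.1 hR.isOpen_compl a haR
    have hfar : ∀ z ∈ R, r ≤ ‖z - a‖ := by
      intro z hz
      by_contra! hlt
      exact hball (mem_ball_iff_norm.2 hlt) hz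
    refine ⟨r / 2, by positivity, fun b hb => ?_⟩
    rw [mem_ball_iff_norm] at hb
    constructor
    · intro h'
      refine h'.of_norm_lt fun z hz => ?_
      linarith [hfar z hz]
    · intro h'
      refine h'.of_norm_lt fun z hz => ?_
      have h1 : ‖z - a‖ ≤ ‖z - b‖ + ‖b - a‖ := by
        simpa using norm_add_le (z - b) (b - a)
      rw [norm_sub_rev a b]
      linarith [hfar z hz]
  have hset : ∀ Q : E2 → Prop, (∀ a ∈ U, ∃ r > 0, ∀ b ∈ Metric.ball a r, (Q a → Q b)) →
      IsOpen {b | ∃ a ∈ U, Q a ∧ ∃ r > 0, (∀ c ∈ Metric.ball a r, (Q a → Q c)) ∧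
        b ∈ Metric.ball a r} := by
    intro Q _
    rw [isOpen_iff_mem_nhds]
    rintro b ⟨a, ha, hQ, r, hr, hc, hb⟩
    filter_upwards [Metric.isOpen_ball.mem_nhds hb] with b' hb'
    exact ⟨a, ha, hQ, r, hr, hc, hb'⟩
  have h1 : ∀ a ∈ U, ∃ r > 0, ∀ b ∈ Metric.ball a r, (HasLogOn R a → HasLogOn R b) := by
    intro a ha
    obtain ⟨r, hr, hb⟩ := hloc a ha
    exact ⟨r, hr, fun b hb' => (hb b hb').1⟩
  have h2 : ∀ a ∈ U, ∃ r > 0, ∀ b ∈ Metric.ball a r, (¬HasLogOn R a → ¬HasLogOn R b) := by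
    intro a ha
    obtain ⟨r, hr, hb⟩ := hloc a ha
    exact ⟨r, hr, fun b hb' => mt (hb b hb').2⟩
  by_contra hcon
  obtain ⟨c, -, ⟨a, -, ha, r, hr, hc, hca⟩, ⟨b, -, hb, r', hr', hc', hcb⟩⟩ :=
    hU _ _ (hset (HasLogOn R) h1) (hset (fun a => ¬HasLogOn R a) h2)
      (fun a ha => by
        by_cases hQ : HasLogOn R a
        · obtain ⟨r, hr, hb⟩ := h1 a ha
          exact Or.inl ⟨a, ha, hQ, r, hr, hb, Metric.mem_ball_self hr⟩
        · obtain ⟨r, hr, hb⟩ := h2 a ha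
          exact Or.inr ⟨a, ha, hQ, r, hr, hb, Metric.mem_ball_self hr⟩)
      (by
        obtain ⟨r, hr, hb⟩ := h1 m hm
        exact ⟨m, hm, m, hm, h, r, hr, hb, Metric.mem_ball_self hr⟩)
      (by
        obtain ⟨r, hr, hb⟩ := h2 n hn
        exact ⟨n, hn, n, hn, hcon, r, hr, hb, Metric.mem_ball_self hr⟩)
  exact hc' c hcb hb (hc c hca ha)

/-! ### Separation along a slit -/

/-- The quotient `(z - M) / (z - N)` in the complex plane. -/
def slitQuotient (M N z : E2) : ℂ := planeToComplex (z - M) / planeToComplex (z - N)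

lemma slitQuotient_im (M N z : E2) :
    (slitQuotient M N z).im = -cross2 (N - M) (z - M) / Complex.normSq (planeToComplex (z - N)) := by
  simp only [slitQuotient, Complex.div_im, planeToComplex_re, planeToComplex_im, cross2,
    PiLp.sub_apply]
  ring

lemma slitQuotient_re_of_line (M N : E2) (τ : ℝ) :
    (slitQuotient M N (M + τ • (N - M))).re =
      τ * (τ - 1) * Complex.normSq (planeToComplex (N - M)) /
        Complex.normSq (planeToComplex (M + τ • (N - M) - N)) := by
  simp only [slitQuotient, Complex.div_re, planeToComplex_re, planeToComplex_im,
    Complex.normSq_apply, PiLp.sub_apply, PiLp.add_apply, PiLp.smul_apply, smul_eq_mul]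
  ring

lemma slitQuotient_mem_slitPlane {M N z : E2} (hMN : M ≠ N) (hz : z ∉ segment ℝ M N) :
    slitQuotient M N z ∈ Complex.slitPlane := by
  have hzN : z ≠ N := fun e => hz (e ▸ right_mem_segment ℝ M N)
  have hpos : 0 < Complex.normSq (planeToComplex (z - N)) :=
    Complex.normSq_pos.2 (planeToComplex_sub_ne_zero hzN)
  rw [Complex.mem_slitPlane_iff]
  by_cases hc : cross2 (N - M) (z - M) = 0
  · left
    obtain ⟨τ, hτ⟩ := exists_smul_eq_of_cross2_eq_zero (sub_ne_zero.2 hMN.symm) hc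
    obtain rfl : z = M + τ • (N - M) := by rw [← hτ]; abel
    rw [slitQuotient_re_of_line]
    have hNM : 0 < Complex.normSq (planeToComplex (N - M)) :=
      Complex.normSq_pos.2 (planeToComplex_sub_ne_zero hMN.symm)
    have hτ' : 0 < τ * (τ - 1) := by
      by_contra! hle
      apply hz
      rw [segment_eq_image']
      refine ⟨τ, ⟨?_, ?_⟩, rfl⟩ <;> nlinarith
    positivity
  · right
    rw [slitQuotient_im]
    exact div_ne_zero (neg_ne_zero.2 hc) hpos.ne'

lemma neg_slitQuotient_mem_slitPlane {M N z : E2} (hMN : M ≠ N)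
    (hz : cross2 (N - M) (z - M) ≠ 0 ∨ ∃ τ ∈ Ioo (0 : ℝ) 1, z = M + τ • (N - M)) :
    z ≠ M ∧ z ≠ N ∧ -slitQuotient M N z ∈ Complex.slitPlane := by
  have hzMN : z ≠ M ∧ z ≠ N := by
    rcases hz with hz | ⟨τ, hτ, rfl⟩
    · constructor <;> rintro rfl <;> apply hz <;> simp [cross2]; ring
    · have hne : N - M ≠ 0 := sub_ne_zero.2 hMN.symm
      constructor
      · simpa using ⟨hτ.1.ne', hne⟩
      · intro e
        have : (τ - 1) • (N - M) = 0 := by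
          rw [sub_smul, one_smul, sub_eq_zero]
          nth_rewrite 2 [← e]
          abel
        rcases smul_eq_zero.1 this with h | h
        · linarith [hτ.2]
        · exact hne h
  refine ⟨hzMN.1, hzMN.2, ?_⟩
  have hpos : 0 < Complex.normSq (planeToComplex (z - N)) :=
    Complex.normSq_pos.2 (planeToComplex_sub_ne_zero hzMN.2)
  rw [Complex.mem_slitPlane_iff, Complex.neg_re, Complex.neg_im]
  rcases hz with hz | ⟨τ, hτ, rfl⟩
  · right
    rw [slitQuotient_im]
    exact neg_ne_zero.2 (div_ne_zero (neg_ne_zero.2 hz) hpos.ne')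
  · left
    rw [slitQuotient_re_of_line]
    have hNM : 0 < Complex.normSq (planeToComplex (N - M)) :=
      Complex.normSq_pos.2 (planeToComplex_sub_ne_zero hMN.symm)
    have : 0 < τ * (1 - τ) := mul_pos hτ.1 (by linarith [hτ.2])
    rw [← neg_div]
    apply div_pos _ hpos
    nlinarith

lemma continuousOn_slitQuotient (M N : E2) : ContinuousOn (slitQuotient M N) {N}ᶜ :=
  (continuous_planeToComplex_sub M).continuousOn.div
    (continuous_planeToComplex_sub N).continuousOn fun _ hz => planeToComplex_sub_ne_zero hz

lemma IsPreconnected.eq_of_continuousOn_int {S : Set E2} (hS : IsPreconnected S) {f : E2 → ℂ}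
    (hf : ContinuousOn f S) (hfint : ∀ z ∈ S, ∃ n : ℤ, f z = n) {z₁ z₂ : E2} (h₁ : z₁ ∈ S)
    (h₂ : z₂ ∈ S) : f z₁ = f z₂ := by
  have hdisc : IsDiscrete (range ((↑) : ℤ → ℝ)) :=
    Int.isClosedEmbedding_coe_real.isEmbedding.isDiscrete_range
  have hre : (f z₁).re = (f z₂).re := by
    refine hS.constant_of_mapsTo hdisc (f := fun z => (f z).re)
      (Complex.continuous_re.comp_continuousOn hf) (fun z hz => ?_) h₁ h₂
    obtain ⟨n, hn⟩ := hfint z hz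
    exact ⟨n, by simp [hn]⟩
  obtain ⟨n₁, hn₁⟩ := hfint z₁ h₁
  obtain ⟨n₂, hn₂⟩ := hfint z₂ h₂
  rw [hn₁, hn₂] at hre ⊢
  simpa using hre

lemma log_eq_log_neg_add {w : ℂ} (hw : 0 < w.im) :
    Complex.log w = Complex.log (-w) + Real.pi * Complex.I := by
  simp only [Complex.log, norm_neg, Complex.arg_neg_eq_arg_sub_pi_of_im_pos hw]
  push_cast
  ring

lemma log_eq_log_neg_sub {w : ℂ} (hw : w.im < 0) :
    Complex.log w = Complex.log (-w) - Real.pi * Complex.I := by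
  simp only [Complex.log, norm_neg, Complex.arg_neg_eq_arg_add_pi_of_im_neg hw]
  push_cast
  ring

/-- A set `R` on which both ends of a slit have continuous logarithms is separated by the slit:
there is an index `k`, constant on connected subsets of `R` off the slit, and an index `l`,
constant on connected subsets of `R` meeting the line of the slit only inside the slit, such
that `k = l + 1` on one side of the line and `k = l` on the other. -/
lemma exists_slit_index {R : Set E2} {M N : E2} (hMN : M ≠ N) (hM : HasLogOn R M)
    (hN : HasLogOn R N) :
    ∃ k l : E2 → ℂ,
      (∀ S : Set E2, IsPreconnected S → S ⊆ R \ segment ℝ M N →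
        ∀ z₁ ∈ S, ∀ z₂ ∈ S, k z₁ = k z₂) ∧
      (∀ S : Set E2, IsPreconnected S → S ⊆ R →
        (∀ z ∈ S, cross2 (N - M) (z - M) ≠ 0 ∨ ∃ τ ∈ Ioo (0 : ℝ) 1, z = M + τ • (N - M)) →
        ∀ z₁ ∈ S, ∀ z₂ ∈ S, l z₁ = l z₂) ∧
      (∀ z, 0 < cross2 (N - M) (z - M) → k z = l z + 1) ∧
      (∀ z, cross2 (N - M) (z - M) < 0 → k z = l z) := by
  obtain ⟨g, hg, hge⟩ := hM
  obtain ⟨h, hh, hhe⟩ := hN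
  have hpi : (2 * Real.pi * Complex.I : ℂ) ≠ 0 := Complex.two_pi_I_ne_zero
  have hexp : ∀ z ∈ R, z ≠ M → z ≠ N → Complex.exp (g z - h z) = slitQuotient M N z := by
    intro z hz h1 h2
    rw [Complex.exp_sub, hge z ⟨hz, h1⟩, hhe z ⟨hz, h2⟩, slitQuotient]
  have hne : ∀ z, z ≠ M → z ≠ N → slitQuotient M N z ≠ 0 := fun z h1 h2 =>
    div_ne_zero (planeToComplex_sub_ne_zero h1) (planeToComplex_sub_ne_zero h2)
  refine ⟨fun z => (g z - h z - Complex.log (slitQuotient M N z)) / (2 * Real.pi * Complex.I),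
    fun z => (g z - h z - Complex.log (-slitQuotient M N z) - Real.pi * Complex.I) /
      (2 * Real.pi * Complex.I), ?_, ?_, ?_, ?_⟩
  · intro S hS hSR z₁ h₁ z₂ h₂
    have hSM : ∀ z ∈ S, z ≠ M := fun z hz e => (hSR hz).2 (e ▸ left_mem_segment ℝ M N)
    have hSN : ∀ z ∈ S, z ≠ N := fun z hz e => (hSR hz).2 (e ▸ right_mem_segment ℝ M N)
    refine hS.eq_of_continuousOn_int (ContinuousOn.div_const (ContinuousOn.sub
      (ContinuousOn.sub (hg.mono ?_) (hh.mono ?_)) (ContinuousOn.clog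
      ((continuousOn_slitQuotient M N).mono hSN) ?_)) _) ?_ h₁ h₂
    · exact fun z hz => ⟨(hSR hz).1, hSM z hz⟩
    · exact fun z hz => ⟨(hSR hz).1, hSN z hz⟩
    · exact fun z hz => slitQuotient_mem_slitPlane hMN (hSR hz).2
    · intro z hz
      have : Complex.exp (g z - h z - Complex.log (slitQuotient M N z)) = 1 := by
        have h0 := hne z (hSM z hz) (hSN z hz)
        rw [Complex.exp_sub, hexp z (hSR hz).1 (hSM z hz) (hSN z hz), Complex.exp_log h0,
          div_self h0]
      obtain ⟨n, hn⟩ := Complex.exp_eq_one_iff.1 this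
      exact ⟨n, (congrArg (· / _) hn).trans (mul_div_cancel_right₀ _ hpi)⟩
  · intro S hS hSR hline z₁ h₁ z₂ h₂
    have hl := fun z hz => neg_slitQuotient_mem_slitPlane hMN (hline z hz)
    refine hS.eq_of_continuousOn_int (ContinuousOn.div_const (ContinuousOn.sub (ContinuousOn.sub
      (ContinuousOn.sub (hg.mono ?_) (hh.mono ?_)) (ContinuousOn.clog
      (((continuousOn_slitQuotient M N).mono ?_).neg) ?_)) continuousOn_const) _) ?_ h₁ h₂
    · exact fun z hz => ⟨hSR hz, (hl z hz).1⟩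
    · exact fun z hz => ⟨hSR hz, (hl z hz).2.1⟩
    · exact fun z hz => (hl z hz).2.1
    · exact fun z hz => (hl z hz).2.2
    · intro z hz
      have : Complex.exp (g z - h z - Complex.log (-slitQuotient M N z) - Real.pi * Complex.I)
          = 1 := by
        have h0 := hne z (hl z hz).1 (hl z hz).2.1
        rw [Complex.exp_sub, Complex.exp_sub, hexp z (hSR hz) (hl z hz).1 (hl z hz).2.1,
          Complex.exp_log (neg_ne_zero.2 h0), Complex.exp_pi_mul_I]
        field_simp
      obtain ⟨n, hn⟩ := Complex.exp_eq_one_iff.1 this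
      exact ⟨n, (congrArg (· / _) hn).trans (mul_div_cancel_right₀ _ hpi)⟩
  all_goals
    intro z hz
    have hzN : z ≠ N := by
      rintro rfl
      apply hz.ne'
      simp [cross2]
      ring
    have hpos : 0 < Complex.normSq (planeToComplex (z - N)) :=
      Complex.normSq_pos.2 (planeToComplex_sub_ne_zero hzN)
  · beta_reduce
    rw [log_eq_log_neg_sub (w := slitQuotient M N z)
      (by rw [slitQuotient_im]; exact div_neg_of_neg_of_pos (by linarith) hpos)]
    rw [div_add_one hpi]
    ring
  · beta_reduce
    rw [log_eq_log_neg_add (w := slitQuotient M N z)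
      (by rw [slitQuotient_im]; exact div_pos (by linarith) hpos)]
    ring

lemma HasLogOn.of_segment {R : Set E2} {m M : E2} (hm : HasLogOn R m) (hmR : m ∉ R) (hne : M ≠ m)
    (h : ∀ z ∈ segment ℝ M m, z ∈ R → z = M) : HasLogOn R M :=
  hm.transfer hmR fun z hz => slitQuotient_mem_slitPlane hne fun hz' => hz.2 (h z hz' hz.1)

/-! ### Segments near a point -/

lemma exists_segment_conic {p q : E2} (hpq : p ≠ q) (B : E2) :
    ∃ ε > 0, ∀ z : E2, ‖z‖ < ε → ∀ t ∈ Ioc (0 : ℝ) 1,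
      (B + z ∈ segment ℝ p q ↔ B + t • z ∈ segment ℝ p q) := by
  have hcl : IsClosed (segment ℝ p q) := by
    rw [segment_eq_image']
    exact (isCompact_Icc.image (by fun_prop)).isClosed
  by_cases hB : B ∈ segment ℝ p q
  · obtain ⟨s, hs, rfl⟩ := (segment_eq_image' ℝ p q ▸ hB)
    obtain ⟨c, hc, hc0, hc1⟩ : ∃ c : ℝ, 0 < c ∧ (0 < s → c ≤ s) ∧ (s < 1 → c ≤ 1 - s) := by
      rcases hs.1.eq_or_lt with h | h
      · exact ⟨1, one_pos, fun h' => by linarith, fun _ => by linarith⟩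
      rcases hs.2.eq_or_lt with h' | h'
      · exact ⟨1, one_pos, fun _ => by linarith, fun _ => by linarith⟩
      · exact ⟨min s (1 - s), lt_min h (by linarith), fun _ => min_le_left _ _,
          fun _ => min_le_right _ _⟩
    have hnorm : 0 < ‖q - p‖ := norm_pos_iff.2 (sub_ne_zero.2 hpq.symm)
    refine ⟨c * ‖q - p‖, by positivity, fun z hz t ht => ⟨fun h => ?_, fun h => ?_⟩⟩
    · have := (convex_segment p q).add_smul_sub_mem hB h (t := t) ⟨ht.1.le, ht.2⟩
      simpa using this
    · rw [segment_eq_image'] at h ⊢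
      obtain ⟨r, hr, hrz⟩ := h
      have hz' : z = ((r - s) / t) • (q - p) := by
        have h1 : t • z = (r - s) • (q - p) := by
          have h2 : p + r • (q - p) = p + s • (q - p) + t • z := hrz
          linear_combination (norm := module) -h2
        rw [div_eq_inv_mul, mul_smul, ← h1, smul_smul, inv_mul_cancel₀ ht.1.ne', one_smul]
      rw [hz', norm_smul, Real.norm_eq_abs] at hz
      have habs := abs_lt.1 (lt_of_mul_lt_mul_right hz hnorm.le)
      refine ⟨s + (r - s) / t, ⟨?_, ?_⟩, ?_⟩
      · rcases hs.1.eq_or_lt with h | h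
        · have : 0 ≤ (r - s) / t := div_nonneg (by linarith [hr.1]) ht.1.le
          linarith
        · linarith [hc0 h]
      · rcases hs.2.eq_or_lt with h | h
        · have : (r - s) / t ≤ 0 := div_nonpos_of_nonpos_of_nonneg (by linarith [hr.2]) ht.1.le
          linarith
        · linarith [hc1 h]
      · simp only [hz', add_smul]
        abel
  · obtain ⟨ε, hε, hball⟩ := Metric.isOpen_iff.1 hcl.isOpen_compl B hB
    refine ⟨ε, hε, fun z hz t ht => ⟨fun h => ?_, fun h => ?_⟩⟩
    · exact absurd h (hball (by simpa using hz))
    · refine absurd h (hball ?_)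
      simp only [mem_ball_iff_norm, add_sub_cancel_left, norm_smul, Real.norm_eq_abs,
        abs_of_pos ht.1]
      nlinarith [norm_nonneg z, ht.2]

lemma add_mem_segment_iff_of_left {B c z : E2} (hz : ‖z‖ < ‖c - B‖) :
    B + z ∈ segment ℝ B c ↔ ∃ t : ℝ, 0 ≤ t ∧ z = t • (c - B) := by
  rw [segment_eq_image']
  constructor
  · rintro ⟨t, ht, h⟩
    exact ⟨t, ht.1, (add_left_cancel h).symm⟩
  · rintro ⟨t, ht, rfl⟩
    refine ⟨t, ⟨ht, ?_⟩, rfl⟩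
    by_contra! h
    rw [norm_smul, Real.norm_of_nonneg ht] at hz
    nlinarith [norm_nonneg (c - B)]

lemma exists_add_mem_segment_iff {p q B : E2} (hB : B ∈ segment ℝ p q) (hp : B ≠ p) (hq : B ≠ q) :
    ∃ ε > 0, ∀ z : E2, ‖z‖ < ε → (B + z ∈ segment ℝ p q ↔
      (∃ t : ℝ, 0 ≤ t ∧ z = t • (q - p)) ∨ ∃ t : ℝ, 0 ≤ t ∧ z = t • -(q - p)) := by
  obtain ⟨s, hs, rfl⟩ := (segment_eq_image' ℝ p q ▸ hB)
  have hpq : p ≠ q := by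
    rintro rfl
    simp at hp
  have hs0 : 0 < s := hs.1.lt_of_ne (by rintro rfl; simp at hp)
  have hs1 : s < 1 := hs.2.lt_of_ne (by rintro rfl; simp at hq)
  have hnorm : 0 < ‖q - p‖ := norm_pos_iff.2 (sub_ne_zero.2 hpq.symm)
  refine ⟨min s (1 - s) * ‖q - p‖, mul_pos (lt_min hs0 (by linarith)) hnorm, fun z hz => ?_⟩
  have key : ∀ t : ℝ, z = t • (q - p) → p + s • (q - p) + z ∈ segment ℝ p q := by
    rintro t rfl
    rw [norm_smul, Real.norm_eq_abs] at hz
    have habs := abs_lt.1 (lt_of_mul_lt_mul_right hz hnorm.le)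
    have h1 := min_le_left s (1 - s)
    have h2 := min_le_right s (1 - s)
    rw [segment_eq_image']
    refine ⟨s + t, ⟨by linarith, by linarith⟩, ?_⟩
    simp only [add_smul]
    abel
  constructor
  · rw [segment_eq_image']
    rintro ⟨r, hr, hrz⟩
    have hz' : z = (r - s) • (q - p) := by
      have h2 : p + r • (q - p) = p + s • (q - p) + z := hrz
      linear_combination (norm := module) -h2
    rcases le_total 0 (r - s) with h | h
    · exact Or.inl ⟨_, h, hz'⟩
    · exact Or.inr ⟨-(r - s), by linarith, by rw [hz', smul_neg, neg_smul, neg_neg]⟩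
  · rintro (⟨t, -, h⟩ | ⟨t, -, h⟩)
    · exact key t h
    · exact key (-t) (by rw [h, smul_neg, neg_smul])

namespace SimplePolygon

variable (P : SimplePolygon)

instance : NeZero P.n := ⟨by have := P.three_le; omega⟩

instance : Fact (1 < P.n) := ⟨by have := P.three_le; omega⟩

/-! ### The region bounded by the polygon -/

lemma isCompact_boundary : IsCompact P.boundary := by
  refine isCompact_iUnion fun i => ?_
  rw [segment_eq_image']
  exact isCompact_Icc.image (by fun_prop)

lemma boundary_subset_region : P.boundary ⊆ P.region := subset_union_left

variable {P}

lemma mem_region_iff_of_isPreconnected {S : Set E2} (hS : IsPreconnected S)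
    (hSb : ∀ z ∈ S, z ∉ P.boundary) {z₁ z₂ : E2} (h₁ : z₁ ∈ S) (h₂ : z₂ ∈ S) :
    z₁ ∈ P.region ↔ z₂ ∈ P.region := by
  have : connectedComponentIn P.boundaryᶜ z₁ = connectedComponentIn P.boundaryᶜ z₂ :=
    connectedComponentIn_eq (hS.subset_connectedComponentIn h₁ hSb h₂)
  simp [region, hSb z₁ h₁, hSb z₂ h₂, this]

variable (P)

lemma connectedComponentIn_disjoint_region {z : E2} (hz : z ∉ P.region) :
    Disjoint (connectedComponentIn P.boundaryᶜ z) P.region := by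
  rw [Set.disjoint_left]
  intro y hy hyR
  have hz' : z ∈ P.boundaryᶜ := fun h => hz (P.boundary_subset_region h)
  exact hz ((mem_region_iff_of_isPreconnected isPreconnected_connectedComponentIn
    (fun w hw => connectedComponentIn_subset _ _ hw) (mem_connectedComponentIn hz') hy).2 hyR)

lemma isClosed_region : IsClosed P.region := by
  rw [← isOpen_compl_iff, isOpen_iff_mem_nhds]
  intro z hz
  have hz' : z ∈ P.boundaryᶜ := fun h => hz (P.boundary_subset_region h)
  filter_upwards [P.isCompact_boundary.isClosed.isOpen_compl.connectedComponentIn.mem_nhds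
    (mem_connectedComponentIn hz')] with y hy
  exact Set.disjoint_left.1 (P.connectedComponentIn_disjoint_region hz) hy

lemma isBounded_region : Bornology.IsBounded P.region := by
  obtain ⟨r, hr⟩ := P.isCompact_boundary.isBounded.subset_ball 0
  refine (Metric.isBounded_ball (x := (0 : E2)) (r := max r 1)).subset fun z hz => ?_
  by_contra hzr
  rw [mem_ball_zero_iff, not_lt] at hzr
  have hz1 : 0 < ‖z‖ := one_pos.trans_le ((le_max_right _ _).trans hzr)
  have hray : ∀ s : ℝ, 1 ≤ s → s • z ∉ P.boundary := by
    intro s hs h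
    have := hr h
    rw [mem_ball_zero_iff, norm_smul, Real.norm_of_nonneg (by linarith)] at this
    nlinarith [le_max_left r 1]
  rcases hz with hz | ⟨hzb, hbdd⟩
  · exact hray 1 le_rfl (by simpa using hz)
  · have hpre : IsPreconnected ((fun s : ℝ => s • z) '' Ici 1) :=
      isPreconnected_Ici.image _ (by fun_prop)
    have hsub := hpre.subset_connectedComponentIn (x := z) (F := P.boundaryᶜ)
      ⟨1, by simp, by simp⟩ (by rintro _ ⟨s, hs, rfl⟩; exact hray s hs)
    obtain ⟨ρ, hρ⟩ := (hbdd.subset hsub).subset_ball 0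
    have hmem : (max 1 (ρ / ‖z‖)) • z ∈ Metric.ball (0 : E2) ρ :=
      hρ ⟨max 1 (ρ / ‖z‖), mem_Ici.2 (le_max_left _ _), rfl⟩
    rw [mem_ball_zero_iff, norm_smul, Real.norm_of_nonneg (by positivity)] at hmem
    have h1 : ρ / ‖z‖ * ‖z‖ ≤ max 1 (ρ / ‖z‖) * ‖z‖ :=
      mul_le_mul_of_nonneg_right (le_max_right _ _) hz1.le
    rw [div_mul_cancel₀ _ hz1.ne'] at h1
    linarith

lemma isOpen_region_diff_boundary : IsOpen (P.region \ P.boundary) := by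
  rw [isOpen_iff_mem_nhds]
  rintro z ⟨hz, hzb⟩
  filter_upwards [P.isCompact_boundary.isClosed.isOpen_compl.connectedComponentIn.mem_nhds
    (mem_connectedComponentIn (F := P.boundaryᶜ) hzb)] with y hy
  have hsub : ∀ w ∈ connectedComponentIn P.boundaryᶜ z, w ∉ P.boundary := fun w hw =>
    connectedComponentIn_subset _ _ hw
  exact ⟨(mem_region_iff_of_isPreconnected isPreconnected_connectedComponentIn hsub
    (mem_connectedComponentIn (F := P.boundaryᶜ) hzb) hy).1 hz, hsub y hy⟩

lemma mem_boundary_of_mem_closure_compl {z : E2} (hz : z ∈ P.region)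
    (hz' : z ∈ closure P.regionᶜ) : z ∈ P.boundary := by
  by_contra hzb
  obtain ⟨y, hy, hyR⟩ := mem_closure_iff_nhds.1 hz' _
    (P.isOpen_region_diff_boundary.mem_nhds ⟨hz, hzb⟩)
  exact hyR hy.1

lemma hasLogOn_of_notMem_region {m : E2} (hm : m ∉ P.region) : HasLogOn P.region m := by
  have hmb : m ∈ P.boundaryᶜ := fun h => hm (P.boundary_subset_region h)
  have hunb : ¬Bornology.IsBounded (connectedComponentIn P.boundaryᶜ m) := fun h =>
    hm (Or.inr ⟨hmb, h⟩)
  obtain ⟨r, hr⟩ := P.isBounded_region.subset_ball 0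
  obtain ⟨n, hn, hnr⟩ : ∃ n ∈ connectedComponentIn P.boundaryᶜ m, r ≤ ‖n‖ := by
    by_contra! h
    exact hunb ((Metric.isBounded_ball (x := (0 : E2)) (r := r)).subset fun n hn => by
      simpa using h n hn)
  refine hasLogOn_iff_of_isPreconnected P.isClosed_region isPreconnected_connectedComponentIn
    (P.connectedComponentIn_disjoint_region hm) hn (mem_connectedComponentIn hmb)
    (hasLogOn_of_norm_lt fun z hz => ?_)
  have := hr hz
  rw [mem_ball_zero_iff] at this
  linarith

/-! ### Local structure of the boundary -/

lemma vtx_ne_vtx_succ (i : ZMod P.n) : P.vtx i ≠ P.vtx (i + 1) := fun h => by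
  simpa using P.inj h

lemma sub_one_ne_add_one (k : ZMod P.n) : k - 1 ≠ k + 1 := fun h => by
  have h2 : ((2 : ℕ) : ZMod P.n) = 0 := by
    push_cast
    linear_combination -h
  have := Nat.le_of_dvd two_pos ((ZMod.natCast_eq_zero_iff _ _).1 h2)
  have := P.three_le
  omega

lemma exists_conic (B : E2) : ∃ ε > 0, ∀ z : E2, ‖z‖ < ε → ∀ t ∈ Ioc (0 : ℝ) 1,
    ((B + z ∈ P.boundary ↔ B + t • z ∈ P.boundary) ∧
      (B + z ∈ P.region ↔ B + t • z ∈ P.region)) := by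
  choose ε hε h using fun i : ZMod P.n => exists_segment_conic (P.vtx_ne_vtx_succ i) B
  obtain ⟨δ, hδ, hδε⟩ : ∃ δ > 0, ∀ i, δ ≤ ε i := by
    obtain ⟨i₀, hi₀⟩ := Finite.exists_min ε
    exact ⟨ε i₀, hε i₀, hi₀⟩
  have hb : ∀ z : E2, ‖z‖ < δ → ∀ t ∈ Ioc (0 : ℝ) 1,
      (B + z ∈ P.boundary ↔ B + t • z ∈ P.boundary) := by
    intro z hz t ht
    simp only [boundary, mem_iUnion]
    exact exists_congr fun i => h i z (hz.trans_le (hδε i)) t ht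
  refine ⟨δ, hδ, fun z hz t ht => ⟨hb z hz t ht, ?_⟩⟩
  by_cases hzb : B + z ∈ P.boundary
  · exact iff_of_true (P.boundary_subset_region hzb)
      (P.boundary_subset_region ((hb z hz t ht).1 hzb))
  · refine mem_region_iff_of_isPreconnected (S := (fun s : ℝ => B + s • z) '' Ioc 0 1)
      (isPreconnected_Ioc.image _ (by fun_prop)) ?_ ⟨1, by simp, by simp⟩ ⟨t, ht, rfl⟩
    rintro _ ⟨s, hs, rfl⟩ h'
    exact hzb ((hb z hz s hs).2 h')

lemma eq_vtx_of_mem_edges {i j : ZMod P.n} (hij : i ≠ j) {B : E2}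
    (hi : B ∈ segment ℝ (P.vtx i) (P.vtx (i + 1))) (hj : B ∈ segment ℝ (P.vtx j) (P.vtx (j + 1))) :
    (j = i + 1 ∧ B = P.vtx j) ∨ (i = j + 1 ∧ B = P.vtx i) := by
  have key : ∀ i j : ZMod P.n, B ∈ segment ℝ (P.vtx i) (P.vtx (i + 1)) →
      B ∈ segment ℝ (P.vtx j) (P.vtx (j + 1)) → i + 1 = j → B = P.vtx j := by
    rintro i _ hi hj rfl
    have := P.adj_edges i
    rw [show i + 2 = i + 1 + 1 by ring] at this
    have h : B ∈ ({P.vtx (i + 1)} : Set E2) := this ▸ ⟨hi, hj⟩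
    simpa using h
  by_cases h1 : i + 1 = j
  · exact Or.inl ⟨h1.symm, key i j hi hj h1⟩
  by_cases h2 : j + 1 = i
  · exact Or.inr ⟨h2.symm, key j i hj hi h2⟩
  have : B ∈ (∅ : Set E2) := P.nonadj_edges i j hij h1 h2 ▸ ⟨hi, hj⟩
  exact this.elim

lemma exists_edges_near (B : E2) : ∃ ε > 0, ∀ z : E2, ‖z‖ < ε → ∀ i : ZMod P.n,
    B + z ∈ segment ℝ (P.vtx i) (P.vtx (i + 1)) → B ∈ segment ℝ (P.vtx i) (P.vtx (i + 1)) := by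
  have key : ∀ i : ZMod P.n, ∃ ε > 0, ∀ z : E2, ‖z‖ < ε →
      B + z ∈ segment ℝ (P.vtx i) (P.vtx (i + 1)) → B ∈ segment ℝ (P.vtx i) (P.vtx (i + 1)) := by
    intro i
    by_cases hB : B ∈ segment ℝ (P.vtx i) (P.vtx (i + 1))
    · exact ⟨1, one_pos, fun _ _ _ => hB⟩
    · have hcl : IsClosed (segment ℝ (P.vtx i) (P.vtx (i + 1))) := by
        rw [segment_eq_image']
        exact (isCompact_Icc.image (by fun_prop)).isClosed
      obtain ⟨ε, hε, hball⟩ := Metric.isOpen_iff.1 hcl.isOpen_compl B hB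
      exact ⟨ε, hε, fun z hz h => absurd h (hball (by simpa using hz))⟩
  choose ε hε h using key
  obtain ⟨i₀, hi₀⟩ := Finite.exists_min ε
  exact ⟨ε i₀, hε i₀, fun z hz i => h i z (hz.trans_le (hi₀ i))⟩

/-- Near `B`, the boundary consists of the two distinct rays from `B` in directions `a` and `b`. -/
def IsLocalRays (B a b : E2) : Prop :=
  a ≠ 0 ∧ b ≠ 0 ∧ ¬SameRay ℝ a b ∧ ∃ ε > 0, ∀ z : E2, ‖z‖ < ε →
    (B + z ∈ P.boundary ↔ (∃ t : ℝ, 0 ≤ t ∧ z = t • a) ∨ ∃ t : ℝ, 0 ≤ t ∧ z = t • b)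

variable {P} in
lemma IsLocalRays.symm {B a b : E2} (h : P.IsLocalRays B a b) : P.IsLocalRays B b a := by
  obtain ⟨ha, hb, hab, ε, hε, hz⟩ := h
  exact ⟨hb, ha, fun h' => hab h'.symm, ε, hε, fun z hz' => (hz z hz').trans or_comm⟩

lemma isLocalRays_vtx (k : ZMod P.n) :
    P.IsLocalRays (P.vtx k) (P.vtx (k + 1) - P.vtx k) (P.vtx (k - 1) - P.vtx k) := by
  have hk1 : P.vtx (k + 1) ≠ P.vtx k := (P.vtx_ne_vtx_succ k).symm
  have hk2 : P.vtx (k - 1) ≠ P.vtx k := by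
    have := P.vtx_ne_vtx_succ (k - 1)
    rwa [sub_add_cancel] at this
  have hedge : segment ℝ (P.vtx k) (P.vtx (k - 1)) =
      segment ℝ (P.vtx (k - 1)) (P.vtx (k - 1 + 1)) := by
    rw [sub_add_cancel, segment_symm]
  have hne : k ≠ k - 1 := fun h => hk2 (by rw [← h])
  refine ⟨sub_ne_zero.2 hk1, sub_ne_zero.2 hk2, fun hray => ?_, ?_⟩
  · have hcommon : ∀ B, B ∈ segment ℝ (P.vtx k) (P.vtx (k + 1)) →
        B ∈ segment ℝ (P.vtx k) (P.vtx (k - 1)) → B = P.vtx k := by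
      intro B h1 h2
      rw [hedge] at h2
      rcases P.eq_vtx_of_mem_edges hne h1 h2 with ⟨h, hB⟩ | ⟨-, hB⟩
      · exact absurd h (P.sub_one_ne_add_one k)
      · exact hB
    obtain ⟨r, hr, h⟩ := hray.exists_pos_left (sub_ne_zero.2 hk1) (sub_ne_zero.2 hk2)
    rcases le_total r 1 with h1 | h1
    · refine hk2 (hcommon _ ?_ (right_mem_segment ℝ _ _))
      rw [segment_eq_image']
      exact ⟨r, ⟨hr.le, h1⟩, by simp [h]⟩
    · refine hk1 (hcommon _ (right_mem_segment ℝ _ _) ?_)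
      rw [segment_eq_image']
      refine ⟨r⁻¹, ⟨by positivity, inv_le_one_of_one_le₀ h1⟩, ?_⟩
      simp [← h, smul_smul, hr.ne']
  · obtain ⟨ε, hε, hnear⟩ := P.exists_edges_near (P.vtx k)
    refine ⟨min ε (min ‖P.vtx (k + 1) - P.vtx k‖ ‖P.vtx (k - 1) - P.vtx k‖),
      lt_min hε (lt_min (norm_pos_iff.2 (sub_ne_zero.2 hk1)) (norm_pos_iff.2 (sub_ne_zero.2 hk2))),
      fun z hz => ?_⟩
    rw [lt_min_iff, lt_min_iff] at hz
    rw [← add_mem_segment_iff_of_left hz.2.1, ← add_mem_segment_iff_of_left hz.2.2, hedge]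
    simp only [boundary, mem_iUnion]
    constructor
    · rintro ⟨i, hi⟩
      have hki := hnear z hz.1 i hi
      by_cases hik : i = k
      · exact Or.inl (hik ▸ hi)
      · rcases P.eq_vtx_of_mem_edges hik hki (left_mem_segment ℝ _ _) with ⟨h, -⟩ | ⟨-, h⟩
        · obtain rfl : i = k - 1 := by rw [h]; ring
          exact Or.inr hi
        · exact absurd (P.inj h).symm hik
    · rintro (h | h)
      exacts [⟨_, h⟩, ⟨_, h⟩]

end SimplePolygon

namespace SimplePolygon

variable (P : SimplePolygon)

lemma exists_isLocalRays {B : E2} (hB : B ∈ P.boundary) :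
    ∃ a b, P.IsLocalRays B a b ∧
      (b = -a ∨ ∃ k, P.vtx k = B ∧ a = P.vtx (k + 1) - B ∧ b = P.vtx (k - 1) - B) := by
  by_cases hv : ∃ k, P.vtx k = B
  · obtain ⟨k, rfl⟩ := hv
    exact ⟨_, _, P.isLocalRays_vtx k, Or.inr ⟨k, rfl, rfl, rfl⟩⟩
  push Not at hv
  obtain ⟨i, hi⟩ := mem_iUnion.1 hB
  have hne : P.vtx (i + 1) - P.vtx i ≠ 0 := sub_ne_zero.2 (P.vtx_ne_vtx_succ i).symm
  refine ⟨P.vtx (i + 1) - P.vtx i, -(P.vtx (i + 1) - P.vtx i), ⟨hne, neg_ne_zero.2 hne,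
    fun h => hne (eq_zero_of_sameRay_self_neg h), ?_⟩, Or.inl rfl⟩
  obtain ⟨ε₁, hε₁, h₁⟩ := P.exists_edges_near B
  obtain ⟨ε₂, hε₂, h₂⟩ := exists_add_mem_segment_iff hi (hv i).symm (hv (i + 1)).symm
  refine ⟨min ε₁ ε₂, lt_min hε₁ hε₂, fun z hz => ?_⟩
  rw [lt_min_iff] at hz
  rw [← h₂ z hz.2]
  refine ⟨fun h => ?_, fun h => mem_iUnion.2 ⟨i, h⟩⟩
  obtain ⟨j, hj⟩ := mem_iUnion.1 h
  by_cases hij : i = j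
  · exact hij ▸ hj
  · rcases P.eq_vtx_of_mem_edges hij hi (h₁ z hz.1 j hj) with ⟨-, h⟩ | ⟨-, h⟩
    exacts [absurd h.symm (hv _), absurd h.symm (hv _)]

/-! ### Boundary points are limits of exterior points -/

lemma exists_conic_closure (B : E2) : ∃ ε > 0, ∀ z : E2, ‖z‖ < ε → ∀ t ∈ Ioc (0 : ℝ) 1,
    (B + z ∈ closure P.regionᶜ ↔ B + t • z ∈ closure P.regionᶜ) := by
  obtain ⟨ε, hε, h⟩ := P.exists_conic B
  refine ⟨ε, hε, fun z hz t ht => ⟨fun hc => ?_, fun hc => ?_⟩⟩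
  · have hc' : B + z ∈ closure (Metric.ball B ε ∩ P.regionᶜ) :=
      Metric.isOpen_ball.inter_closure ⟨by simpa using hz, hc⟩
    have := map_mem_closure (f := fun y => B + t • (y - B)) (t := P.regionᶜ) (by fun_prop) hc' ?_
    · simpa using this
    · rintro y ⟨hy, hyR⟩ hyR'
      rw [mem_ball_iff_norm] at hy
      exact hyR (by simpa using ((h (y - B) hy t ht).2).2 hyR')
  · have hc' : B + t • z ∈ closure (Metric.ball B (t * ε) ∩ P.regionᶜ) := by
      refine Metric.isOpen_ball.inter_closure ⟨?_, hc⟩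
      simp only [mem_ball_iff_norm, add_sub_cancel_left, norm_smul, Real.norm_of_nonneg ht.1.le]
      exact mul_lt_mul_of_pos_left hz ht.1
    have := map_mem_closure (f := fun y => B + t⁻¹ • (y - B)) (t := P.regionᶜ) (by fun_prop) hc' ?_
    · simpa [smul_smul, ht.1.ne'] using this
    · rintro y ⟨hy, hyR⟩ hyR'
      have hy' : ‖t⁻¹ • (y - B)‖ < ε := by
        rw [mem_ball_iff_norm] at hy
        rwa [norm_smul, norm_inv, Real.norm_of_nonneg ht.1.le, inv_mul_lt_iff₀ ht.1]
      have h' := ((h _ hy' t ht).2).1 hyR'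
      rw [smul_smul, mul_inv_cancel₀ ht.1.ne', one_smul, add_sub_cancel] at h'
      exact hyR h'

lemma isPreconnected_ball_diff_ray {b : E2} (hb : b ≠ 0) {ε : ℝ} (hε : 0 < ε) :
    IsPreconnected (Metric.ball (0 : E2) ε \ {z | ∃ t : ℝ, 0 ≤ t ∧ z = t • b}) := by
  have hb' : 0 < ‖b‖ := norm_pos_iff.2 hb
  set c : ℝ := ε / (2 * ‖b‖) with hc
  have hc0 : 0 < c := by positivity
  have hmem : (-c) • b ∈ Metric.ball (0 : E2) ε := by
    rw [mem_ball_zero_iff, norm_smul, norm_neg, Real.norm_of_nonneg hc0.le, hc]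
    field_simp
    linarith
  have hinj : ∀ s t : ℝ, s • b = t • b → s = t := fun s t h => smul_left_injective ℝ hb h
  have hstar : StarConvex ℝ ((-c) • b)
      (Metric.ball (0 : E2) ε \ {z | ∃ t : ℝ, 0 ≤ t ∧ z = t • b}) := by
    rintro z ⟨hz, hzb⟩ r s hr hs hrs
    refine ⟨convex_ball _ _ hmem hz hr hs hrs, ?_⟩
    rintro ⟨t, ht, h⟩
    rcases hs.eq_or_lt with rfl | hs
    · rw [add_zero] at hrs
      rw [hrs, zero_smul, add_zero, one_smul] at h
      linarith [hinj _ _ h]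
    · refine hzb ⟨s⁻¹ * (t + r * c), by positivity, ?_⟩
      have h' : s • z = (t + r * c) • b := by linear_combination (norm := module) h
      rw [mul_smul, ← h', smul_smul, inv_mul_cancel₀ hs.ne', one_smul]
  have hnot : (-c) • b ∉ {z : E2 | ∃ t : ℝ, 0 ≤ t ∧ z = t • b} := by
    rintro ⟨t, ht, h⟩
    linarith [hinj _ _ h]
  exact (hstar.isPathConnected ⟨hmem, hnot⟩).isConnected.isPreconnected

variable {P} in
lemma IsLocalRays.mem_closure_compl {B a b : E2} (h : P.IsLocalRays B a b)
    (hB : B ∈ closure P.regionᶜ) :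
    ∃ ε > 0, ∀ t : ℝ, 0 ≤ t → ‖t • a‖ < ε → B + t • a ∈ closure P.regionᶜ := by
  obtain ⟨ha, hb, hab, ε₁, hε₁, h₁⟩ := h
  obtain ⟨ε₂, hε₂, h₂⟩ := P.exists_conic_closure B
  have hε : 0 < min ε₁ ε₂ := lt_min hε₁ hε₂
  refine ⟨min ε₁ ε₂, hε, fun t₀ ht₀ hta => ?_⟩
  rcases ht₀.eq_or_lt with rfl | ht₀
  · simpa using hB
  by_contra hcon
  have hray : ∀ t : ℝ, 0 < t → ‖t • a‖ < min ε₁ ε₂ → B + t • a ∉ closure P.regionᶜ := by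
    intro t ht htn hmem
    rcases le_total t t₀ with hle | hle
    · refine hcon ((h₂ _ (hta.trans_le (min_le_right _ _)) (t / t₀)
        ⟨by positivity, (div_le_one ht₀).2 hle⟩).2 ?_)
      rwa [smul_smul, div_mul_cancel₀ _ ht₀.ne']
    · have := (h₂ _ (htn.trans_le (min_le_right _ _)) (t₀ / t)
        ⟨by positivity, (div_le_one ht).2 hle⟩).1 hmem
      rw [smul_smul, div_mul_cancel₀ _ ht.ne'] at this
      exact hcon this
  obtain ⟨y, hy, hyR⟩ := Metric.mem_closure_iff.1 hB _ hε
  have hshift : Continuous fun z : E2 => B + z := by fun_prop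
  have hcover : Metric.ball (0 : E2) (min ε₁ ε₂) \ {z | ∃ t : ℝ, 0 ≤ t ∧ z = t • b} ⊆
      (fun z => B + z) ⁻¹' P.regionᶜ ∪ (fun z => B + z) ⁻¹' (closure P.regionᶜ)ᶜ := by
    rintro z ⟨hz, hzb⟩
    rw [mem_ball_zero_iff] at hz
    by_cases hzR : B + z ∈ P.region
    · refine Or.inr fun hc => ?_
      rcases (h₁ z (hz.trans_le (min_le_left _ _))).1 (P.mem_boundary_of_mem_closure_compl hzR hc)
        with ⟨t, ht, rfl⟩ | h
      · rcases ht.eq_or_lt with rfl | ht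
        · exact hzb ⟨0, le_rfl, by simp⟩
        · exact hray t ht hz hc
      · exact hzb h
    · exact Or.inl hzR
  have hyb : y - B ∉ {z : E2 | ∃ t : ℝ, 0 ≤ t ∧ z = t • b} := by
    intro hyb
    refine hy (P.boundary_subset_region ?_)
    have := (h₁ (y - B) ?_).2 (Or.inr hyb)
    · simpa using this
    · rw [← norm_neg, neg_sub, ← dist_eq_norm]
      exact hyR.trans_le (min_le_left _ _)
  have htab : t₀ • a ∉ {z : E2 | ∃ t : ℝ, 0 ≤ t ∧ z = t • b} := by
    rintro ⟨t, ht, h⟩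
    have h1 : SameRay ℝ (t₀ • a) b := h ▸ SameRay.sameRay_nonneg_smul_left b ht
    exact hab ((SameRay.sameRay_pos_smul_right a ht₀).trans h1
      fun h0 => absurd h0 (smul_ne_zero ht₀.ne' ha))
  obtain ⟨z, -, hz₁, hz₂⟩ := isPreconnected_ball_diff_ray hb hε _ _
    (P.isClosed_region.isOpen_compl.preimage hshift)
    (isClosed_closure.isOpen_compl.preimage hshift) hcover
    ⟨y - B, ⟨by simpa [dist_eq_norm, norm_sub_rev] using hyR, hyb⟩, by simpa using hy⟩
    ⟨t₀ • a, ⟨by simpa using hta, htab⟩, hcon⟩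
  exact hz₂ (subset_closure hz₁)

lemma isPreconnected_boundary : IsPreconnected P.boundary := by
  have : P.boundary = ⋃ i : ℕ, segment ℝ (P.vtx (i : ZMod P.n)) (P.vtx ((i : ZMod P.n) + 1)) := by
    refine Subset.antisymm (iUnion_subset fun i => ?_)
      (iUnion_subset fun i => subset_iUnion_of_subset (i : ZMod P.n) subset_rfl)
    exact subset_iUnion_of_subset i.val (by rw [ZMod.natCast_zmod_val])
  rw [this]
  refine IsPreconnected.iUnion_of_chain (fun i => (convex_segment _ _).isPreconnected)
    fun i => ⟨P.vtx ((i : ZMod P.n) + 1), right_mem_segment ℝ _ _, ?_⟩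
  rw [Order.succ_eq_add_one, Nat.cast_add_one]
  exact left_mem_segment ℝ _ _

lemma boundary_subset_closure_compl {B : E2} (hB : B ∈ P.boundary)
    (hB' : B ∈ closure P.regionᶜ) : P.boundary ⊆ closure P.regionᶜ := by
  by_contra hcon
  obtain ⟨D, hD, hD'⟩ := not_subset.1 hcon
  have key : ∀ A ∈ P.boundary, A ∈ closure P.regionᶜ →
      A ∈ interior {y | y ∈ P.boundary → y ∈ closure P.regionᶜ} := by
    intro A hA hA'
    obtain ⟨a, b, hab, -⟩ := P.exists_isLocalRays hA
    obtain ⟨ε₁, hε₁, h₁⟩ := hab.mem_closure_compl hA'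
    obtain ⟨ε₂, hε₂, h₂⟩ := hab.symm.mem_closure_compl hA'
    obtain ⟨-, -, -, ε₃, hε₃, h₃⟩ := hab
    refine mem_interior_iff_mem_nhds.2 (Metric.mem_nhds_iff.2
      ⟨min ε₁ (min ε₂ ε₃), lt_min hε₁ (lt_min hε₂ hε₃), fun y hy hyb => ?_⟩)
    rw [mem_ball_iff_norm, lt_min_iff, lt_min_iff] at hy
    rcases (h₃ (y - A) hy.2.2).1 (by simpa using hyb) with ⟨t, ht, h⟩ | ⟨t, ht, h⟩
    · simpa [← h] using h₁ t ht (h ▸ hy.1)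
    · simpa [← h] using h₂ t ht (h ▸ hy.2.1)
  obtain ⟨y, hy, hyU, hyV⟩ := P.isPreconnected_boundary _ (closure P.regionᶜ)ᶜ isOpen_interior
    isClosed_closure.isOpen_compl (fun y hy => by
      by_cases h : y ∈ closure P.regionᶜ
      exacts [Or.inl (key y hy h), Or.inr h]) ⟨B, hB, key B hB hB'⟩ ⟨D, hD, hD'⟩
  exact hyV (interior_subset hyU hy)

lemma hasLogOn_of_mem_closure_compl {N : E2} (hN : N ∈ closure P.regionᶜ) :
    HasLogOn P.region N := by
  obtain ⟨ε, hε, h⟩ := P.exists_conic N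
  obtain ⟨m, hm, hNm⟩ := Metric.mem_closure_iff.1 hN ε hε
  by_cases hne : N = m
  · exact hne ▸ P.hasLogOn_of_notMem_region hm
  refine (P.hasLogOn_of_notMem_region hm).of_segment hm hne ?_
  intro z hz hzR
  rw [segment_eq_image'] at hz
  obtain ⟨t, ht, rfl⟩ := hz
  rcases ht.1.eq_or_lt with rfl | ht0
  · simp
  · have := ((h (m - N) (by rwa [← norm_neg, neg_sub, ← dist_eq_norm]) t ⟨ht0, ht.2⟩).2).2 hzR
    rw [add_sub_cancel] at this
    exact absurd this hm

/-! ### Shooting rays inside the polygon -/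

lemma exists_first_hit {p f : E2} (hf : f ≠ 0) {δ : ℝ} (hδ : 0 < δ)
    (h : ∀ s ∈ Ioo 0 δ, p + s • f ∈ P.region \ P.boundary) :
    ∃ t : ℝ, 0 < t ∧ p + t • f ∈ P.boundary ∧ ∀ s ∈ Ioo 0 t, p + s • f ∈ P.region \ P.boundary := by
  have hcont : Continuous fun s : ℝ => p + s • f := by fun_prop
  set S : Set ℝ := Ici δ ∩ (fun s : ℝ => p + s • f) ⁻¹' P.boundary with hS
  have hScl : IsClosed S := isClosed_Ici.inter (P.isCompact_boundary.isClosed.preimage hcont)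
  have hSbdd : BddBelow S := ⟨δ, fun s hs => hs.1⟩
  have hprop : ∀ T : Set ℝ, IsPreconnected T → T ⊆ Ioi 0 → (∀ s ∈ T, s ∉ S) → ∀ s₀ ∈ T, s₀ < δ →
      ∀ s ∈ T, p + s • f ∈ P.region \ P.boundary := by
    intro T hT hT0 hTS s₀ hs₀ hs₀δ s hs
    have hb : ∀ s ∈ T, p + s • f ∉ P.boundary := by
      intro s hs hsb
      rcases lt_or_ge s δ with h' | h'
      · exact (h s ⟨hT0 hs, h'⟩).2 hsb
      · exact hTS s hs ⟨h', hsb⟩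
    refine ⟨(mem_region_iff_of_isPreconnected (hT.image _ hcont.continuousOn) ?_
      (mem_image_of_mem _ hs₀) (mem_image_of_mem _ hs)).1 (h s₀ ⟨hT0 hs₀, hs₀δ⟩).1, hb s hs⟩
    rintro _ ⟨s, hs, rfl⟩
    exact hb s hs
  have hSne : S.Nonempty := by
    by_contra hcon
    rw [not_nonempty_iff_eq_empty] at hcon
    obtain ⟨r, hr⟩ := P.isBounded_region.subset_ball p
    have hf' : 0 < ‖f‖ := norm_pos_iff.2 hf
    have hmem := hprop (Ioi 0) isPreconnected_Ioi subset_rfl (by simp [hcon]) (δ / 2)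
      (by simpa using hδ) (by linarith) ((|r| + 1) / ‖f‖) (by simp only [mem_Ioi]; positivity)
    have := hr hmem.1
    rw [mem_ball_iff_norm, add_sub_cancel_left, norm_smul, Real.norm_of_nonneg (by positivity),
      div_mul_cancel₀ _ hf'.ne'] at this
    linarith [le_abs_self r]
  have hmem := hScl.csInf_mem hSne hSbdd
  have ht0 : δ ≤ sInf S := hmem.1
  refine ⟨sInf S, by linarith, hmem.2, fun s hs => ?_⟩
  refine hprop (Ioo 0 (sInf S)) isPreconnected_Ioo (fun s hs => hs.1)
    (fun s hs hsS => absurd (csInf_le hSbdd hsS) (not_le.2 hs.2)) (δ / 2)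
    ⟨by linarith, by linarith⟩ (by linarith) s hs

end SimplePolygon

/-! ### Cuts with minimal pockets -/

namespace SimplePolygon

variable {P : SimplePolygon}

lemma Cut.eq_of_generator_eq {C C' : P.Cut} (hi : C.i = C'.i) (hj : C.j = C'.j) : C = C' := by
  have key : ∀ D D' : P.Cut, D.i = D'.i → D.j = D'.j → D'.t ≤ D.t := by
    intro D D' h1 h2
    by_contra! hlt
    exact D'.first_hit D.t ⟨D.t_pos, hlt⟩ (h1 ▸ h2 ▸ D.hits)
  have ht : C.t = C'.t := le_antisymm (key C' C hi.symm hj.symm) (key C C' hi hj)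
  cases C
  cases C'
  simp_all

instance : Finite P.Cut :=
  Finite.of_injective (fun C : P.Cut => (C.i, C.j)) fun _ _ h =>
    Cut.eq_of_generator_eq (congrArg Prod.fst h) (congrArg Prod.snd h)

lemma Cut.exists_nonredundant_subset (C : P.Cut) :
    ∃ D : P.Cut, D.Nonredundant ∧ D.pocket ⊆ C.pocket := by
  obtain ⟨D, hD, hmin⟩ := (Set.toFinite {D : P.Cut | D.pocket ⊆ C.pocket}).exists_minimalFor
    Cut.pocket _ ⟨C, mem_ofPred.2 subset_rfl⟩
  refine ⟨D, ?_, hD⟩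
  rintro ⟨D', hD'⟩
  exact hD'.2 (hmin (hD'.1.trans hD) hD'.1)

lemma Cut.inter_pocket_nonempty {S : Set E2}
    (hS : ∀ C : P.Cut, C.Nonredundant → (S ∩ C.seg).Nonempty) (C : P.Cut) :
    (S ∩ C.pocket).Nonempty := by
  obtain ⟨D, hD, hDC⟩ := C.exists_nonredundant_subset
  exact (hS D hD).mono (inter_subset_inter_right _ (subset_union_right.trans hDC))

end SimplePolygon

/-! ### Oriented area forms -/

/-- The area form on the plane, scaled by `σ`. -/
def wedge (σ : ℝ) (a b : E2) : ℝ := σ * cross2 a b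

section wedge

variable (σ : ℝ)

lemma wedge_add_right (a b c : E2) : wedge σ a (b + c) = wedge σ a b + wedge σ a c := by
  simp only [wedge, cross2, PiLp.add_apply]; ring

lemma wedge_smul_right (t : ℝ) (a b : E2) : wedge σ a (t • b) = t * wedge σ a b := by
  simp only [wedge, cross2, PiLp.smul_apply, smul_eq_mul]; ring

lemma wedge_neg_right (a b : E2) : wedge σ a (-b) = -wedge σ a b := by
  simp only [wedge, cross2, PiLp.neg_apply]; ring

lemma wedge_smul_left (t : ℝ) (a b : E2) : wedge σ (t • a) b = t * wedge σ a b := by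
  simp only [wedge, cross2, PiLp.smul_apply, smul_eq_mul]; ring

lemma wedge_neg_left (a b : E2) : wedge σ (-a) b = -wedge σ a b := by
  simp only [wedge, cross2, PiLp.neg_apply]; ring

lemma wedge_swap (a b : E2) : wedge σ a b = -wedge σ b a := by
  simp only [wedge, cross2]; ring

@[simp] lemma wedge_self (a : E2) : wedge σ a a = 0 := by
  simp only [wedge, cross2]; ring

@[simp] lemma wedge_zero_left (a : E2) : wedge σ 0 a = 0 := by
  simp [wedge, cross2]

variable {σ} in
lemma exists_smul_eq_of_wedge_eq_zero (hσ : σ ≠ 0) {a b : E2} (ha : a ≠ 0) (h : wedge σ a b = 0) :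
    ∃ t : ℝ, b = t • a :=
  exists_smul_eq_of_cross2_eq_zero ha ((mul_eq_zero.1 h).resolve_left hσ)

end wedge

/-- Separation of the two sides of a slit `[M, M + τ • f]` whose endpoints are accessible from
outside of `R`: `k` is locally constant off the slit, `l` is locally constant off the rest of the
line through the slit, and their values on the two sides of the slit differ. -/
lemma exists_slit_separation {σ : ℝ} (hσ : σ ≠ 0) {R : Set E2} {M f : E2} {τ : ℝ} (hτ : 0 < τ)
    (hf : f ≠ 0) (hM : HasLogOn R M) (hN : HasLogOn R (M + τ • f)) :
    ∃ k l : E2 → ℂ,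
      (∀ S, IsPreconnected S → S ⊆ R → (∀ z ∈ S, z ∉ segment ℝ M (M + τ • f)) →
        ∀ z₁ ∈ S, ∀ z₂ ∈ S, k z₁ = k z₂) ∧
      (∀ S, IsPreconnected S → S ⊆ R →
        (∀ z ∈ S, wedge σ f (z - M) ≠ 0 ∨ ∃ s ∈ Ioo 0 τ, z = M + s • f) →
        ∀ z₁ ∈ S, ∀ z₂ ∈ S, l z₁ = l z₂) ∧
      (∀ z₁ z₂, 0 < wedge σ f (z₁ - M) → wedge σ f (z₂ - M) < 0 → l z₁ = l z₂ → k z₁ ≠ k z₂) := by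
  have hMN : M ≠ M + τ • f := by simp [hτ.ne', hf]
  obtain ⟨k, l, hk, hl, hpos, hneg⟩ := exists_slit_index hMN hM hN
  have hcross : ∀ z, cross2 (M + τ • f - M) z = τ * cross2 f z := fun z => by
    rw [add_sub_cancel_left]
    simp only [cross2, PiLp.smul_apply, smul_eq_mul]
    ring
  simp only [hcross] at hl hpos hneg
  refine ⟨k, l, fun S hS hSR h => hk S hS fun z hz => ⟨hSR hz, h z hz⟩,
    fun S hS hSR h => hl S hS hSR fun z hz => ?_, fun z₁ z₂ h₁ h₂ heq => ?_⟩
  · rcases h z hz with h | ⟨s, hs, h⟩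
    · exact Or.inl (mul_ne_zero hτ.ne' (right_ne_zero_of_mul h))
    · refine Or.inr ⟨s / τ, ⟨div_pos hs.1 hτ, (div_lt_one hτ).2 hs.2⟩, ?_⟩
      rw [add_sub_cancel_left, smul_smul, div_mul_cancel₀ _ hτ.ne', h]
  · unfold wedge at h₁ h₂
    rcases lt_or_gt_of_ne hσ with h | h
    · rw [hneg z₁ (mul_neg_of_pos_of_neg hτ (neg_of_mul_pos_right h₁ h.le)),
        hpos z₂ (mul_pos hτ (pos_of_mul_neg_right h₂ h.le)), heq]
      simp
    · rw [hpos z₁ (mul_pos hτ (pos_of_mul_pos_right h₁ h.le)),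
        hneg z₂ (mul_neg_of_pos_of_neg hτ (neg_of_mul_neg_right h₂ h.le)), heq]
      simp

/-! ### The boundary near a point where a line of sight turns -/

namespace SimplePolygon

variable {P : SimplePolygon}

/-- Near `M`, the exterior of `P` is the open cone spanned by `a` and `b`, whose orientation is
negative with respect to `wedge σ`. -/
def IsExteriorCone (P : SimplePolygon) (σ : ℝ) (M a b : E2) (ε : ℝ) : Prop :=
  (∀ z : E2, ‖z‖ < ε → wedge σ b z < 0 → M + z ∈ P.region \ P.boundary) ∧
  (∀ z : E2, ‖z‖ < ε → 0 < wedge σ a z → M + z ∈ P.region \ P.boundary) ∧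
  (∀ z : E2, ‖z‖ < ε → wedge σ a z < 0 → 0 < wedge σ b z → M + z ∉ P.region)

lemma add_segment_iff {S : Set E2} {M z₁ z₂ : E2} {ε : ℝ}
    (h : ∀ z : E2, ‖z‖ < ε → (M + z ∈ P.boundary ↔ z ∈ S)) (h₁ : ‖z₁‖ < ε) (h₂ : ‖z₂‖ < ε)
    (hS : ∀ r s : ℝ, 0 ≤ r → 0 ≤ s → r + s = 1 → r • z₁ + s • z₂ ∉ S) :
    M + z₁ ∈ P.region ↔ M + z₂ ∈ P.region := by
  refine mem_region_iff_of_isPreconnected (S := (fun z => M + z) '' segment ℝ z₁ z₂)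
    ((convex_segment _ _).isPreconnected.image _ (by fun_prop)) ?_
    ⟨z₁, left_mem_segment ℝ _ _, rfl⟩ ⟨z₂, right_mem_segment ℝ _ _, rfl⟩
  rintro _ ⟨_, ⟨r, s, hr, hs, hrs, rfl⟩, rfl⟩ hb
  refine hS r s hr hs hrs ((h _ ?_).1 hb)
  simpa using convex_ball (0 : E2) ε (by simpa using h₁) (by simpa using h₂) hr hs hrs

lemma exists_pos_norm_smul_lt (z : E2) {ε : ℝ} (hε : 0 < ε) :
    ∃ δ > 0, ∀ s : ℝ, |s| ≤ δ → ‖s • z‖ < ε := by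
  refine ⟨ε / (2 * (‖z‖ + 1)), by positivity, fun s hs => ?_⟩
  rw [norm_smul, Real.norm_eq_abs]
  calc |s| * ‖z‖ ≤ ε / (2 * (‖z‖ + 1)) * (‖z‖ + 1) := by gcongr; linarith
    _ = ε / 2 := by field_simp
    _ < ε := by linarith

lemma notMem_ray_of_wedge_neg {σ : ℝ} {c u z : E2} (hu : 0 ≤ wedge σ c u) (hz : wedge σ c z < 0) :
    ¬∃ t : ℝ, 0 ≤ t ∧ z = t • u := by
  rintro ⟨t, ht, rfl⟩
  rw [wedge_smul_right] at hz
  nlinarith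

lemma notMem_ray_of_wedge_pos {σ : ℝ} {c u z : E2} (hu : wedge σ c u ≤ 0) (hz : 0 < wedge σ c z) :
    ¬∃ t : ℝ, 0 ≤ t ∧ z = t • u := by
  rintro ⟨t, ht, rfl⟩
  rw [wedge_smul_right] at hz
  nlinarith

lemma combo_pos {u v r s : ℝ} (hu : 0 < u) (hv : 0 < v) (hr : 0 ≤ r) (hs : 0 ≤ s)
    (hrs : r + s = 1) : 0 < r * u + s * v := by
  rcases hr.eq_or_lt with rfl | hr
  · have : s = 1 := by linarith
    simpa [this] using hv
  · positivity

lemma isExteriorCone_of_rays {σ : ℝ} (hσ : σ ≠ 0) {M a b d z₀ : E2} {ε : ℝ} (hε : 0 < ε)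
    (ha : a ≠ 0) (hb : b ≠ 0)
    (hbd : ∀ z : E2, ‖z‖ < ε → (M + z ∈ P.boundary ↔
      (∃ t : ℝ, 0 ≤ t ∧ z = t • a) ∨ ∃ t : ℝ, 0 ≤ t ∧ z = t • b))
    (hab : wedge σ a b < 0) (hdb : 0 < wedge σ d b) (hd : ‖d‖ < ε) (hdR : M + d ∈ P.region)
    (hz₀ : ‖z₀‖ < ε) (hz₀R : M + z₀ ∉ P.region) : P.IsExteriorCone σ M a b ε := by
  have hba : 0 < wedge σ b a := by rw [wedge_swap]; linarith
  have hbd' : wedge σ b d < 0 := by rw [wedge_swap]; linarith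
  have hright : ∀ z : E2, ‖z‖ < ε → wedge σ b z < 0 → M + z ∈ P.region \ P.boundary := by
    intro z hz hbz
    refine ⟨(add_segment_iff hbd hd hz fun r s hr hs hrs => ?_).1 hdR, fun h => ?_⟩
    · have hneg : wedge σ b (r • d + s • z) < 0 := by
        rw [wedge_add_right, wedge_smul_right, wedge_smul_right]
        have := combo_pos (neg_pos.2 hbd') (neg_pos.2 hbz) hr hs hrs
        linarith
      exact not_or.2 ⟨notMem_ray_of_wedge_neg hba.le hneg,
        notMem_ray_of_wedge_neg (wedge_self σ b).ge hneg⟩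
    · exact not_or.2 ⟨notMem_ray_of_wedge_neg hba.le hbz,
        notMem_ray_of_wedge_neg (wedge_self σ b).ge hbz⟩ ((hbd z hz).1 h)
  have hleft : ∀ z : E2, ‖z‖ < ε → 0 < wedge σ a z → M + z ∈ P.region \ P.boundary := by
    intro z hz haz
    obtain ⟨δ, hδ, hδn⟩ := exists_pos_norm_smul_lt (a + b) hε
    have hgn : ‖(-δ) • (a + b)‖ < ε := hδn _ (by rw [abs_neg, abs_of_pos hδ])
    have hag : 0 < wedge σ a ((-δ) • (a + b)) := by
      rw [wedge_smul_right, wedge_add_right, wedge_self]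
      nlinarith
    have hgR := hright _ hgn (by
      rw [wedge_smul_right, wedge_add_right, wedge_self]
      nlinarith)
    refine ⟨(add_segment_iff hbd hgn hz fun r s hr hs hrs => ?_).1 hgR.1, fun h => ?_⟩
    · have hpos : 0 < wedge σ a (r • (-δ) • (a + b) + s • z) := by
        rw [wedge_add_right, wedge_smul_right, wedge_smul_right _ s]
        exact combo_pos hag haz hr hs hrs
      exact not_or.2 ⟨notMem_ray_of_wedge_pos (wedge_self σ a).le hpos,
        notMem_ray_of_wedge_pos hab.le hpos⟩
    · exact not_or.2 ⟨notMem_ray_of_wedge_pos (wedge_self σ a).le haz,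
        notMem_ray_of_wedge_pos hab.le haz⟩ ((hbd z hz).1 h)
  have hbz₀ : 0 < wedge σ b z₀ := by
    by_contra! hcon
    rcases hcon.eq_or_lt with h0 | h0
    · obtain ⟨t, rfl⟩ := exists_smul_eq_of_wedge_eq_zero hσ hb h0
      rcases le_or_gt 0 t with ht | ht
      · exact hz₀R (P.boundary_subset_region ((hbd _ hz₀).2 (Or.inr ⟨t, ht, rfl⟩)))
      · refine hz₀R (hleft _ hz₀ ?_).1
        rw [wedge_smul_right]
        nlinarith
    · exact hz₀R (hright _ hz₀ h0).1
  have haz₀ : wedge σ a z₀ < 0 := by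
    by_contra! hcon
    rcases hcon.eq_or_lt with h0 | h0
    · obtain ⟨t, rfl⟩ := exists_smul_eq_of_wedge_eq_zero hσ ha h0.symm
      rw [wedge_smul_right] at hbz₀
      exact hz₀R (P.boundary_subset_region ((hbd _ hz₀).2
        (Or.inl ⟨t, (pos_of_mul_pos_left hbz₀ hba.le).le, rfl⟩)))
    · exact hz₀R (hleft _ hz₀ h0).1
  refine ⟨hright, hleft, fun z hz haz hbz hzR => hz₀R ?_⟩
  refine (add_segment_iff hbd hz₀ hz fun r s hr hs hrs => ?_).2 hzR
  refine not_or.2 ⟨notMem_ray_of_wedge_neg (σ := σ) (wedge_self σ a).ge ?_,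
    notMem_ray_of_wedge_pos (σ := σ) (wedge_self σ b).le ?_⟩
  · rw [wedge_add_right, wedge_smul_right, wedge_smul_right]
    have := combo_pos (neg_pos.2 haz₀) (neg_pos.2 haz) hr hs hrs
    linarith
  · rw [wedge_add_right, wedge_smul_right, wedge_smul_right]
    exact combo_pos hbz₀ hbz hr hs hrs

lemma IsLocalRays.exists_isExteriorCone {σ : ℝ} (hσ : σ ≠ 0) {M a b d : E2} (hd : d ≠ 0)
    (hab : P.IsLocalRays M a b)
    (hbad : ∀ ε > 0, ∃ z : E2, ‖z‖ < ε ∧ 0 < wedge σ d z ∧ M + z ∉ P.region)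
    {δ : ℝ} (hδ : 0 < δ) (hline : ∀ s : ℝ, |s| ≤ δ → M + s • d ∈ P.region)
    (hleft : ∀ s ∈ Ioc 0 δ, ∃ η > 0, ∀ z : E2, ‖z‖ < η → 0 < wedge σ d z →
      M + s • d + z ∈ P.region) :
    ∃ a' b', (a' = a ∧ b' = b ∨ a' = b ∧ b' = a) ∧ 0 < wedge σ d b' ∧ wedge σ a' b' < 0 ∧
      (0 < wedge σ d a' ∨ ∃ c : ℝ, 0 < c ∧ a' = -(c • d)) ∧
      ∃ ε > 0, P.IsExteriorCone σ M a' b' ε := by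
  obtain ⟨ha, hb, hsame, ε, hε, hbd⟩ := hab
  obtain ⟨z₀, hz₀, hdz₀, hz₀R⟩ := hbad ε hε
  obtain ⟨δ', hδ', hδn⟩ := exists_pos_norm_smul_lt d (half_pos hε)
  set δ₀ := min δ δ' with hδ₀def
  have hδ₀ : 0 < δ₀ := lt_min hδ hδ'
  have hδ₀n : ‖δ₀ • d‖ < ε / 2 := hδn _ (by rw [abs_of_pos hδ₀]; exact min_le_right _ _)
  have hplusR : M + δ₀ • d ∈ P.region := hline _ (by rw [abs_of_pos hδ₀]; exact min_le_left _ _)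
  have hminusR : M + (-δ₀) • d ∈ P.region :=
    hline _ (by rw [abs_neg, abs_of_pos hδ₀]; exact min_le_left _ _)
  have hminusn : ‖(-δ₀) • d‖ < ε := by rw [neg_smul, norm_neg]; linarith
  obtain ⟨η, hη, hηR⟩ := hleft δ₀ ⟨hδ₀, min_le_left _ _⟩
  obtain ⟨η', hη', hηn⟩ := exists_pos_norm_smul_lt z₀ (lt_min hη (half_pos hε))
  have hηz := hηn η' (abs_of_pos hη').le
  rw [lt_min_iff] at hηz
  have hcR : M + (δ₀ • d + η' • z₀) ∈ P.region := by
    rw [← add_assoc]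
    refine hηR _ hηz.1 ?_
    rw [wedge_smul_right]
    positivity
  have hcn : ‖δ₀ • d + η' • z₀‖ < ε := (norm_add_le _ _).trans_lt (by linarith [hηz.2])
  have hdc : 0 < wedge σ d (δ₀ • d + η' • z₀) := by
    rw [wedge_add_right, wedge_smul_right, wedge_self, wedge_smul_right, mul_zero, zero_add]
    positivity
  have hdseg : ∀ r s : ℝ, 0 ≤ r → 0 ≤ s → r + s = 1 →
      0 < wedge σ d (r • z₀ + s • (δ₀ • d + η' • z₀)) := by
    intro r s hr hs hrs
    rw [wedge_add_right, wedge_smul_right, wedge_smul_right]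
    exact combo_pos hdz₀ hdc hr hs hrs
  have hopposite : ∀ a b : E2, a ≠ 0 → b ≠ 0 → (∀ z : E2, ‖z‖ < ε → (M + z ∈ P.boundary ↔
      (∃ t : ℝ, 0 ≤ t ∧ z = t • a) ∨ ∃ t : ℝ, 0 ≤ t ∧ z = t • b)) → 0 < wedge σ d b →
      wedge σ d a ≤ 0 → ∃ c : ℝ, 0 < c ∧ a = -(c • d) := by
    intro a b ha hb hbd hdb hda
    by_contra! hcon
    rcases lt_trichotomy (wedge σ b z₀) 0 with h | h | h
    · refine hz₀R ((add_segment_iff hbd hz₀ hcn fun r s hr hs hrs => ?_).2 hcR)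
      refine not_or.2 ⟨notMem_ray_of_wedge_pos hda (hdseg r s hr hs hrs),
        notMem_ray_of_wedge_neg (σ := σ) (wedge_self σ b).ge ?_⟩
      have hbc : wedge σ b (δ₀ • d + η' • z₀) < 0 := by
        rw [wedge_add_right, wedge_smul_right, wedge_smul_right, wedge_swap σ b d]
        nlinarith
      rw [wedge_add_right, wedge_smul_right, wedge_smul_right]
      have := combo_pos (neg_pos.2 h) (neg_pos.2 hbc) hr hs hrs
      linarith
    · obtain ⟨t, rfl⟩ := exists_smul_eq_of_wedge_eq_zero hσ hb h
      rw [wedge_smul_right] at hdz₀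
      exact hz₀R (P.boundary_subset_region ((hbd _ hz₀).2
        (Or.inr ⟨t, (pos_of_mul_pos_left hdz₀ hdb.le).le, rfl⟩)))
    · refine hz₀R ((add_segment_iff hbd hz₀ hminusn fun r s hr hs hrs => ?_).2 hminusR)
      refine not_or.2 ⟨?_, notMem_ray_of_wedge_pos (σ := σ) (wedge_self σ b).le ?_⟩
      · rcases hr.eq_or_lt with rfl | hr
        · obtain rfl : s = 1 := by linarith
          rintro ⟨t, ht, h⟩
          have ht0 : 0 < t := ht.lt_of_ne (by
            rintro rfl
            simp [hδ₀.ne', hd] at h)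
          refine hcon (t⁻¹ * δ₀) (by positivity) ?_
          rw [mul_smul, ← smul_neg, ← neg_smul, ← one_smul ℝ ((-δ₀) • d), ← zero_add ((1 : ℝ) • _),
            ← zero_smul ℝ z₀, h, smul_smul, inv_mul_cancel₀ ht0.ne', one_smul]
        · refine notMem_ray_of_wedge_pos hda ?_
          rw [wedge_add_right, wedge_smul_right, wedge_smul_right, wedge_smul_right, wedge_self]
          have := mul_pos hr hdz₀
          linarith
      · rw [wedge_add_right, wedge_smul_right, wedge_smul_right]
        refine combo_pos h ?_ hr hs hrs
        rw [wedge_smul_right, wedge_swap]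
        nlinarith
  have hsomeleft : 0 < wedge σ d a ∨ 0 < wedge σ d b := by
    by_contra! hcon
    refine hz₀R ((add_segment_iff hbd hz₀ hcn fun r s hr hs hrs => ?_).2 hcR)
    exact not_or.2 ⟨notMem_ray_of_wedge_pos hcon.1 (hdseg r s hr hs hrs),
      notMem_ray_of_wedge_pos hcon.2 (hdseg r s hr hs hrs)⟩
  have hbd' : ∀ z : E2, ‖z‖ < ε → (M + z ∈ P.boundary ↔
      (∃ t : ℝ, 0 ≤ t ∧ z = t • b) ∨ ∃ t : ℝ, 0 ≤ t ∧ z = t • a) :=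
    fun z hz => (hbd z hz).trans or_comm
  have hδ₀n' : ‖δ₀ • d‖ < ε := by linarith
  have hdd : ∀ c : E2, 0 < wedge σ d c → 0 < wedge σ (δ₀ • d) c := fun c hc => by
    rw [wedge_smul_left]
    positivity
  have hfin : ∀ a b : E2, a ≠ 0 → b ≠ 0 → (∀ z : E2, ‖z‖ < ε → (M + z ∈ P.boundary ↔
      (∃ t : ℝ, 0 ≤ t ∧ z = t • a) ∨ ∃ t : ℝ, 0 ≤ t ∧ z = t • b)) → 0 < wedge σ d b →
      wedge σ d a ≤ 0 → wedge σ a b < 0 ∧ (0 < wedge σ d a ∨ ∃ c : ℝ, 0 < c ∧ a = -(c • d)) ∧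
      ∃ ε > 0, P.IsExteriorCone σ M a b ε := by
    intro a b ha hb hbd hdb hda
    obtain ⟨c, hc, h⟩ := hopposite a b ha hb hbd hdb hda
    have hneg : wedge σ a b < 0 := by
      rw [h, wedge_neg_left, wedge_smul_left]
      have := mul_pos hc hdb
      linarith
    exact ⟨hneg, Or.inr ⟨c, hc, h⟩, ε, hε, isExteriorCone_of_rays hσ hε ha hb hbd hneg
      (hdd b hdb) hδ₀n' hplusR hz₀ hz₀R⟩
  by_cases hda : 0 < wedge σ d a
  · by_cases hdb : 0 < wedge σ d b
    · rcases lt_trichotomy (wedge σ a b) 0 with h | h | h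
      · exact ⟨a, b, Or.inl ⟨rfl, rfl⟩, hdb, h, Or.inl hda, ε, hε,
          isExteriorCone_of_rays hσ hε ha hb hbd h (hdd b hdb) hδ₀n' hplusR hz₀ hz₀R⟩
      · obtain ⟨t, rfl⟩ := exists_smul_eq_of_wedge_eq_zero hσ ha h
        rw [wedge_smul_right] at hdb
        exact absurd (SameRay.sameRay_nonneg_smul_right a (pos_of_mul_pos_left hdb hda.le).le) hsame
      · rw [wedge_swap, neg_pos] at h
        exact ⟨b, a, Or.inr ⟨rfl, rfl⟩, hda, h, Or.inl hdb, ε, hε,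
          isExteriorCone_of_rays hσ hε hb ha hbd' h (hdd a hda) hδ₀n' hplusR hz₀ hz₀R⟩
    · exact ⟨b, a, Or.inr ⟨rfl, rfl⟩, hda, hfin b a hb ha hbd' hda (not_lt.1 hdb)⟩
  · have hdb := hsomeleft.resolve_left hda
    exact ⟨a, b, Or.inl ⟨rfl, rfl⟩, hdb, hfin a b ha hb hbd hdb (not_lt.1 hda)⟩

end SimplePolygon

/-! ### A cut whose pocket is avoided -/

lemma mem_segment_add {M u v z : E2} (h : z ∈ segment ℝ (M + u) (M + v)) :
    ∃ r s : ℝ, 0 ≤ r ∧ 0 ≤ s ∧ r + s = 1 ∧ z = M + (r • u + s • v) := by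
  obtain ⟨r, s, hr, hs, hrs, rfl⟩ := h
  refine ⟨r, s, hr, hs, hrs, ?_⟩
  obtain rfl : r = 1 - s := by linarith
  module

lemma mem_segment_add_smul {M f z : E2} {t : ℝ} (ht : 0 ≤ t) (h : z ∈ segment ℝ M (M + t • f)) :
    ∃ s ∈ Icc 0 t, z = M + s • f := by
  rw [segment_eq_image'] at h
  obtain ⟨r, hr, rfl⟩ := h
  refine ⟨r * t, ⟨mul_nonneg hr.1 ht, by nlinarith [hr.2]⟩, ?_⟩
  rw [add_sub_cancel_left, mul_smul]

namespace SimplePolygon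

variable {P : SimplePolygon}

lemma segment_subset_of_first_hit {p f : E2} {t : ℝ} (ht : 0 < t) (hp : p ∈ P.region)
    (hhit : p + t • f ∈ P.boundary) (h : ∀ s ∈ Ioo 0 t, p + s • f ∈ P.region \ P.boundary) :
    segment ℝ p (p + t • f) ⊆ P.region := by
  intro z hz
  obtain ⟨s, hs, rfl⟩ := mem_segment_add_smul ht.le hz
  rcases hs.1.eq_or_lt with rfl | hs0
  · simpa using hp
  rcases hs.2.eq_or_lt with rfl | hst
  · exact P.boundary_subset_region hhit
  · exact (h s ⟨hs0, hst⟩).1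

lemma exists_cut_of_first_hit {k j : ZMod P.n} (hj : j = k + 1 ∨ j = k - 1) (hr : P.IsReflex k)
    {t : ℝ} (ht : 0 < t) (hk : P.vtx k ∈ P.region)
    (hhit : P.vtx k + t • -(P.vtx j - P.vtx k) ∈ P.boundary)
    (h : ∀ s ∈ Ioo 0 t, P.vtx k + s • -(P.vtx j - P.vtx k) ∈ P.region \ P.boundary) :
    ∃ C : P.Cut, C.seg = segment ℝ (P.vtx k) (P.vtx k + t • -(P.vtx j - P.vtx k)) ∧
      C.u = P.vtx j := by
  have hseg := segment_subset_of_first_hit ht hk hhit h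
  simp only [neg_sub] at hhit h hseg ⊢
  exact ⟨⟨k, j, hj, hr, t, ht, hhit, fun s hs => (h s hs).2, hseg⟩, rfl, rfl⟩

lemma visible_add_smul {x d : E2} {c : ℝ} (hc : 0 ≤ c)
    (h : ∀ r ∈ Icc 0 c, x + r • d ∈ P.region) : P.Visible x (x + c • d) := by
  intro z hz
  obtain ⟨s, hs, rfl⟩ := mem_segment_add_smul hc hz
  exact h s hs

lemma notMem_closure_of_slit {R S Pth : Set E2} {M' q : E2} {k : E2 → ℂ} (hsub : Pth ⊆ R)
    (hpre : IsPreconnected Pth) (hq : q ∈ Pth) (hS : ∀ z ∈ Pth, z ∉ S)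
    (hk : ∀ T, IsPreconnected T → T ⊆ R → (∀ z ∈ T, z ∉ S) → ∀ z₁ ∈ T, ∀ z₂ ∈ T, k z₁ = k z₂)
    (hM' : M' ∈ R \ S) (hne : k q ≠ k M') :
    Pth ∩ (closure (connectedComponentIn (R \ S) M') ∪ S) = ∅ := by
  rw [eq_empty_iff_forall_notMem]
  rintro z ⟨hz, hzc | hzS⟩
  · set Z := connectedComponentIn (R \ S) M'
    have hZ : Z ⊆ R \ S := connectedComponentIn_subset _ _
    have hins : IsPreconnected (insert z Z) :=
      isPreconnected_connectedComponentIn.subset_closure (subset_insert z Z)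
        (insert_subset hzc subset_closure)
    have h1 := hk _ hins (insert_subset (hsub hz) fun y hy => (hZ hy).1) (by
      rintro y (rfl | hy)
      exacts [hS _ hz, (hZ hy).2]) z (mem_insert _ _) M'
      (mem_insert_of_mem _ (mem_connectedComponentIn hM'))
    exact hne ((hk Pth hpre hsub hS q hq z hz).trans h1)
  · exact hS z hz hzS

set_option maxHeartbeats 1000000 in
/-- If a line of sight from `x` in direction `d` is blocked on its left by the exterior cone at the
reflex vertex `M`, then a connected set that starts on the left beyond `M` and is nowhere visible
from `x` avoids the pocket of the cut at `M` along the first side `a` of the cone. -/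
lemma exists_cut_pocket_disjoint {σ : ℝ} (hσ : σ ≠ 0) {Pth : Set E2} (hsub : Pth ⊆ P.region)
    (hpre : IsPreconnected Pth) {x q d b : E2} {α ε : ℝ} {k j : ZMod P.n} (hα : 0 ≤ α)
    (hd : d ≠ 0) (hM : P.vtx k = x + α • d) (hxM : ∀ r ∈ Icc 0 α, x + r • d ∈ P.region)
    (hnvis : ∀ p ∈ Pth, ¬P.Visible x p) (hq : q ∈ Pth) (hdq : 0 < wedge σ d (q - P.vtx k))
    (hj : j = k + 1 ∨ j = k - 1) (hreflex : P.IsReflex k)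
    (hMcl : P.vtx k ∈ closure P.regionᶜ) (hdb : 0 < wedge σ d b)
    (hab : wedge σ (P.vtx j - P.vtx k) b < 0)
    (hda : 0 < wedge σ d (P.vtx j - P.vtx k) ∨ ∃ c : ℝ, 0 < c ∧ P.vtx j - P.vtx k = -(c • d))
    (hε : 0 < ε) (hcone : P.IsExteriorCone σ (P.vtx k) (P.vtx j - P.vtx k) b ε)
    (hedge : segment ℝ (P.vtx k) (P.vtx j) ⊆ P.region)
    {δ₁ : ℝ} (hδ₁ : 0 < δ₁) (hpath : ∀ δ ∈ Ioc 0 δ₁, ∃ G, IsPreconnected G ∧ G ⊆ P.region ∧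
      P.vtx k + δ • d ∈ G ∧ q ∈ G ∧ ∀ z ∈ G, z = P.vtx k + δ • d ∨ 0 < wedge σ d (z - P.vtx k)) :
    ∃ C : P.Cut, Pth ∩ C.pocket = ∅ := by
  set M := P.vtx k with hMdef
  set a := P.vtx j - M with hadef
  have hM' : P.vtx j = M + a := by rw [hadef, add_sub_cancel]
  have hMb : M ∈ P.boundary := mem_iUnion.2 ⟨k, left_mem_segment ℝ _ _⟩
  have hMR : M ∈ P.region := P.boundary_subset_region hMb
  have ha : a ≠ 0 := by
    intro h
    simp [h] at hab
  have hba : 0 < wedge σ b a := by rw [wedge_swap]; linarith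
  have hbd : wedge σ b d < 0 := by rw [wedge_swap]; linarith
  obtain ⟨hright, hleft, -⟩ := hcone
  obtain ⟨δa, hδa, hna⟩ := exists_pos_norm_smul_lt a hε
  obtain ⟨δb, hδb, hnb⟩ := exists_pos_norm_smul_lt b hε
  obtain ⟨δd, hδd, hnd⟩ := exists_pos_norm_smul_lt d hε
  obtain ⟨δ, hδ, hδ1, hδle, hδa', hδb', hδd'⟩ :
      ∃ δ : ℝ, 0 < δ ∧ δ ≤ 1 ∧ δ ≤ δ₁ ∧ δ ≤ δa ∧ δ ≤ δb ∧ δ ≤ δd := by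
    refine ⟨min 1 (min δ₁ (min δa (min δb δd))), by positivity, ?_⟩
    simp
  have hsmall : ∀ s ∈ Icc 0 δ, ‖s • -a‖ < ε ∧ ‖s • -b‖ < ε ∧ ‖s • d‖ < ε := by
    intro s hs
    rw [smul_neg, smul_neg, norm_neg, norm_neg]
    have h := abs_of_nonneg hs.1
    exact ⟨hna s (by linarith [hs.2]), hnb s (by linarith [hs.2]), hnd s (by linarith [hs.2])⟩
  have hδδ : δ ∈ Icc 0 δ := ⟨hδ.le, le_rfl⟩
  have hcombo : ∀ u v : E2, ‖u‖ < ε → ‖v‖ < ε → ∀ r s : ℝ, 0 ≤ r → 0 ≤ s → r + s = 1 →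
      ‖r • u + s • v‖ < ε := by
    intro u v hu hv r s hr hs hrs
    simpa using convex_ball (0 : E2) ε (by simpa using hu) (by simpa using hv) hr hs hrs
  have hnegd : ∀ s ∈ Ioc 0 δ, M + s • d ∈ P.region \ P.boundary := by
    intro s hs
    refine hright _ (hsmall s ⟨hs.1.le, hs.2⟩).2.2 ?_
    rw [wedge_smul_right]
    nlinarith [hs.1]
  have hnega : ∀ s ∈ Ioc 0 δ, M + s • -a ∈ P.region \ P.boundary := by
    intro s hs
    refine hright _ (hsmall s ⟨hs.1.le, hs.2⟩).1 ?_
    rw [wedge_smul_right, wedge_neg_right]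
    nlinarith [hs.1]
  obtain ⟨t, ht, hthit, htR⟩ := P.exists_first_hit (neg_ne_zero.2 ha) hδ
    fun s hs => hnega s ⟨hs.1, hs.2.le⟩
  have hδt : δ < t := by
    by_contra! hcon
    exact (hnega t ⟨ht, hcon⟩).2 hthit
  obtain ⟨C, hCseg, hCu⟩ := exists_cut_of_first_hit hj hreflex ht hMR hthit htR
  have hsegR := segment_subset_of_first_hit ht hMR hthit htR
  have hlog : ∀ N ∈ P.boundary, HasLogOn P.region N := fun N hN =>
    P.hasLogOn_of_mem_closure_compl (P.boundary_subset_closure_compl hMb hMcl hN)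
  have hvis : ∀ s : ℝ, 0 ≤ s → (∀ r ∈ Icc 0 s, M + r • d ∈ P.region) → M + s • d ∉ Pth := by
    intro s hs hsR hmem
    refine hnvis _ hmem ?_
    have : M + s • d = x + (α + s) • d := by rw [hM]; module
    rw [this]
    refine visible_add_smul (by linarith) fun r hr => ?_
    rcases le_total r α with h | h
    · exact hxM r ⟨hr.1, h⟩
    · have := hsR (r - α) ⟨by linarith, by linarith [hr.2]⟩
      rw [hM] at this
      convert this using 1
      module
  have hMPth : M ∉ Pth := by
    have := hvis 0 le_rfl fun r hr => by
      obtain rfl : r = 0 := le_antisymm hr.2 hr.1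
      simpa using hMR
    simpa using this
  obtain ⟨G, hGpre, hGR, hcG, hqG, hGleft⟩ := hpath δ ⟨hδ, hδle⟩
  have hMsub : ∀ z : E2, M + z - M = z := fun z => add_sub_cancel_left M z
  have hsegmem : ∀ s ∈ Icc 0 t, M + s • -a ∈ P.region := by
    intro s hs
    rcases hs.1.eq_or_lt with rfl | hs0
    · simpa using hMR
    rcases hs.2.eq_or_lt with rfl | hst
    exacts [P.boundary_subset_region hthit, (htR s ⟨hs0, hst⟩).1]
  have hsegdisj : ∀ z ∈ Pth, z ∉ segment ℝ M (M + t • -a) := by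
    intro z hz hzseg
    obtain ⟨s, hs, rfl⟩ := mem_segment_add_smul ht.le hzseg
    rcases hda with hda | ⟨c, hc, hac⟩
    · obtain ⟨τ, hτ, hτhit, hτR⟩ := P.exists_first_hit hd hδ fun s hs => hnegd s ⟨hs.1, hs.2.le⟩
      have hδτ : δ < τ := by
        by_contra! hcon
        exact (hnegd τ ⟨hτ, hcon⟩).2 hτhit
      obtain ⟨κ, l, hκ, hl, hopp⟩ :=
        exists_slit_separation hσ hτ hd (hlog M hMb) (hlog _ hτhit)
      have hs0 : 0 < s := hs.1.lt_of_ne (by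
        rintro rfl
        exact hMPth (by simpa using hz))
      have hslit : ∀ y ∈ Pth, y ∉ segment ℝ M (M + τ • d) := by
        intro y hy hyseg
        obtain ⟨r, hr, rfl⟩ := mem_segment_add_smul hτ.le hyseg
        refine hvis r hr.1 (fun r' hr' => ?_) hy
        refine segment_subset_of_first_hit hτ hMR hτhit hτR ?_
        rw [segment_eq_image']
        refine ⟨r' / τ, ⟨div_nonneg hr'.1 hτ.le, (div_le_one hτ).2 (hr'.2.trans hr.2)⟩, ?_⟩
        simp only [hMsub, smul_smul, div_mul_cancel₀ _ hτ.ne']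
      have h1 : κ q = κ (M + s • -a) := hκ Pth hpre hsub hslit q hq _ hz
      have h2 : κ (M + s • -a) = κ (M + δ • -a) := by
        refine hκ ((fun r : ℝ => M + r • -a) '' Ioc 0 t) (isPreconnected_Ioc.image _ (by fun_prop))
          ?_ ?_ _ ⟨s, ⟨hs0, hs.2⟩, rfl⟩ _ ⟨δ, ⟨hδ, hδt.le⟩, rfl⟩
        · rintro _ ⟨r, hr, rfl⟩
          exact hsegmem r ⟨hr.1.le, hr.2⟩
        · rintro _ ⟨r, hr, rfl⟩ hmem
          obtain ⟨r', -, h⟩ := mem_segment_add_smul hτ.le hmem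
          have := congrArg (wedge σ d) (add_left_cancel h)
          rw [wedge_smul_right, wedge_neg_right, wedge_smul_right, wedge_self] at this
          nlinarith [mul_pos hr.1 hda]
      have h3 : l q = l (M + δ • d) := by
        refine hl G hGpre hGR (fun y hy => ?_) q hqG _ hcG
        rcases hGleft y hy with h | h
        · exact Or.inr ⟨δ, ⟨hδ, hδτ⟩, h⟩
        · exact Or.inl h.ne'
      have h4 : l (M + δ • -a) = l (M + δ • d) := by
        refine hl (segment ℝ (M + δ • -a) (M + δ • d)) (convex_segment _ _).isPreconnected ?_ ?_ _
          (left_mem_segment ℝ _ _) _ (right_mem_segment ℝ _ _)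
        · intro y hy
          obtain ⟨r, s, hr, hs, hrs, rfl⟩ := mem_segment_add hy
          refine (hright _ (hcombo _ _ (hsmall δ hδδ).1 (hsmall δ hδδ).2.2 r s hr hs hrs) ?_).1
          rw [wedge_add_right, wedge_smul_right, wedge_smul_right, wedge_neg_right,
            wedge_smul_right, wedge_smul_right]
          have := combo_pos (mul_pos hδ hba) (mul_pos hδ (neg_pos.2 hbd)) hr hs hrs
          linarith
        · intro y hy
          obtain ⟨r, s, hr, hs, hrs, rfl⟩ := mem_segment_add hy
          rcases hr.eq_or_lt with rfl | hr
          · obtain rfl : s = 1 := by linarith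
            exact Or.inr ⟨δ, ⟨hδ, hδτ⟩, by simp⟩
          · refine Or.inl (ne_of_lt ?_)
            rw [hMsub, wedge_add_right, wedge_smul_right, wedge_smul_right, wedge_neg_right,
              wedge_smul_right, wedge_smul_right, wedge_self]
            have := mul_pos hr (mul_pos hδ hda)
            linarith
      refine hopp q (M + δ • -a) hdq ?_ (h3.trans h4.symm) (h1.trans h2)
      rw [hMsub, wedge_smul_right, wedge_neg_right]
      have := mul_pos hδ hda
      linarith
    · have hna : -a = c • d := by rw [hac, neg_neg]
      rw [hna, smul_smul] at hz
      refine hvis (s * c) (mul_nonneg hs.1 hc.le) (fun r hr => ?_) hz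
      have := hsegmem (r / c) ⟨div_nonneg hr.1 hc.le, (div_le_iff₀ hc).2
        (hr.2.trans (mul_le_mul_of_nonneg_right hs.2 hc.le))⟩
      rwa [hna, smul_smul, div_mul_cancel₀ _ hc.ne'] at this
  obtain ⟨κ, l, hκ, hl, hopp⟩ :=
    exists_slit_separation hσ ht (neg_ne_zero.2 ha) (hlog M hMb) (hlog _ hthit)
  have hslitδ : ∃ s ∈ Ioo 0 t, M + δ • -a = M + s • -a := ⟨δ, ⟨hδ, hδt⟩, rfl⟩
  have haray : ∀ r : ℝ, 0 < r → M + r • a ∉ segment ℝ M (M + t • -a) := by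
    intro r hr hmem
    obtain ⟨s, hs, h⟩ := mem_segment_add_smul ht.le hmem
    have h0 : (r + s) • a = 0 := by linear_combination (norm := module) h
    rcases smul_eq_zero.1 h0 with h0 | h0
    · linarith [hs.1]
    · exact ha h0
  have hedgemem : ∀ r ∈ Icc (0 : ℝ) 1, M + r • a ∈ P.region := by
    intro r hr
    refine hedge ?_
    rw [segment_eq_image']
    exact ⟨r, hr, rfl⟩
  have hbside : wedge σ (-a) (M + δ • -b - M) < 0 := by
    rw [hMsub, wedge_neg_left, wedge_smul_right, wedge_neg_right]
    nlinarith
  have hnb : M + δ • -b ∈ P.region := by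
    refine (hleft _ (hsmall δ hδδ).2.1 ?_).1
    rw [wedge_smul_right, wedge_neg_right]
    nlinarith
  have hkM' : κ (P.vtx j) = κ (M + δ • -b) := by
    have h1 : κ (P.vtx j) = κ (M + δ • a) := by
      refine hκ ((fun r : ℝ => M + r • a) '' Icc δ 1) (isPreconnected_Icc.image _ (by fun_prop))
        ?_ ?_ _ ⟨1, ⟨hδ1, le_rfl⟩, by simp [hM']⟩ _ ⟨δ, ⟨le_rfl, hδ1⟩, rfl⟩
      · rintro _ ⟨r, hr, rfl⟩
        exact hedgemem r ⟨hδ.le.trans hr.1, hr.2⟩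
      · rintro _ ⟨r, hr, rfl⟩
        exact haray r (hδ.trans_le hr.1)
    rw [h1]
    have hna : ‖δ • a‖ < ε := by simpa using (hsmall δ hδδ).1
    have hpos : ∀ r s : ℝ, 0 < s → 0 < wedge σ a (r • δ • a + s • δ • -b) := by
      intro r s hs
      rw [wedge_add_right, wedge_smul_right, wedge_smul_right, wedge_self, wedge_smul_right,
        wedge_smul_right, wedge_neg_right]
      have := mul_pos hs (mul_pos hδ (neg_pos.2 hab))
      linarith
    refine hκ (segment ℝ (M + δ • a) (M + δ • -b)) (convex_segment _ _).isPreconnected ?_ ?_ _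
      (left_mem_segment ℝ _ _) _ (right_mem_segment ℝ _ _)
    · intro y hy
      obtain ⟨r, s, hr, hs, hrs, rfl⟩ := mem_segment_add hy
      rcases hs.eq_or_lt with rfl | hs
      · obtain rfl : r = 1 := by linarith
        simpa using hedgemem δ ⟨hδ.le, hδ1⟩
      · exact (hleft _ (hcombo _ _ hna (hsmall δ hδδ).2.1 r s hr hs.le hrs) (hpos r s hs)).1
    · intro y hy
      obtain ⟨r, s, hr, hs, hrs, rfl⟩ := mem_segment_add hy
      rcases hs.eq_or_lt with rfl | hs
      · obtain rfl : r = 1 := by linarith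
        simpa using haray δ hδ
      · intro hmem
        obtain ⟨s', -, h⟩ := mem_segment_add_smul ht.le hmem
        have h2 := hpos r s hs
        rw [add_left_cancel h, wedge_smul_right, wedge_neg_right, wedge_self] at h2
        linarith
  have hne : κ q ≠ κ (P.vtx j) := by
    rw [hkM']
    rcases hda with hda | ⟨c, hc, hac⟩
    · have h1 : κ q = κ (M + δ • d) := by
        refine hκ G hGpre hGR (fun y hy hmem => ?_) q hqG _ hcG
        obtain ⟨s, hs, rfl⟩ := mem_segment_add_smul ht.le hmem
        rcases hGleft _ hy with h | h
        · have h2 := congrArg (wedge σ d) (add_left_cancel h)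
          rw [wedge_smul_right, wedge_neg_right, wedge_smul_right, wedge_self, mul_zero] at h2
          have h3 : s = 0 := by
            rcases mul_eq_zero.1 h2 with h2 | h2
            · exact h2
            · linarith
          rw [h3, zero_smul] at h
          exact smul_ne_zero hδ.ne' hd (add_left_cancel h).symm
        · rw [hMsub, wedge_smul_right, wedge_neg_right] at h
          nlinarith [mul_nonneg hs.1 hda.le]
      have h2 : l (M + δ • d) = l (M + δ • -a) := by
        refine hl (segment ℝ (M + δ • d) (M + δ • -a)) (convex_segment _ _).isPreconnected ?_ ?_ _
          (left_mem_segment ℝ _ _) _ (right_mem_segment ℝ _ _)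
        · intro y hy
          obtain ⟨r, s, hr, hs, hrs, rfl⟩ := mem_segment_add hy
          refine (hright _ (hcombo _ _ (hsmall δ hδδ).2.2 (hsmall δ hδδ).1 r s hr hs hrs) ?_).1
          rw [wedge_add_right, wedge_smul_right, wedge_smul_right, wedge_smul_right,
            wedge_smul_right, wedge_neg_right]
          have := combo_pos (mul_pos hδ (neg_pos.2 hbd)) (mul_pos hδ hba) hr hs hrs
          linarith
        · intro y hy
          obtain ⟨r, s, hr, hs, hrs, rfl⟩ := mem_segment_add hy
          rcases hr.eq_or_lt with rfl | hr
          · obtain rfl : s = 1 := by linarith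
            simpa using Or.inr hslitδ
          · refine Or.inl (ne_of_gt ?_)
            rw [hMsub, wedge_neg_left, wedge_add_right, wedge_smul_right, wedge_smul_right,
              wedge_smul_right, wedge_smul_right, wedge_neg_right, wedge_self, wedge_swap σ a d]
            have := mul_pos hr (mul_pos hδ hda)
            linarith
      have h3 : l (M + δ • -b) = l (M + δ • -a) := by
        refine hl (segment ℝ (M + δ • -b) (M + δ • -a)) (convex_segment _ _).isPreconnected ?_ ?_ _
          (left_mem_segment ℝ _ _) _ (right_mem_segment ℝ _ _)
        · intro y hy
          obtain ⟨r, s, hr, hs, hrs, rfl⟩ := mem_segment_add hy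
          have hn := hcombo _ _ (hsmall δ hδδ).2.1 (hsmall δ hδδ).1 r s hr hs hrs
          rcases hs.eq_or_lt with rfl | hs
          · obtain rfl : r = 1 := by linarith
            simpa using hnb
          · refine (hright _ hn ?_).1
            rw [wedge_add_right, wedge_smul_right, wedge_smul_right, wedge_smul_right,
              wedge_smul_right, wedge_neg_right, wedge_neg_right, wedge_self]
            have := mul_pos hs (mul_pos hδ hba)
            linarith
        · intro y hy
          obtain ⟨r, s, hr, hs, hrs, rfl⟩ := mem_segment_add hy
          rcases hr.eq_or_lt with rfl | hr
          · obtain rfl : s = 1 := by linarith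
            simpa using Or.inr hslitδ
          · refine Or.inl (ne_of_lt ?_)
            rw [hMsub, wedge_neg_left, wedge_add_right, wedge_smul_right, wedge_smul_right,
              wedge_smul_right, wedge_smul_right, wedge_neg_right, wedge_neg_right, wedge_self]
            have := mul_pos hr (mul_pos hδ (neg_pos.2 hab))
            linarith
      rw [h1]
      refine hopp _ _ ?_ hbside (h2.trans h3.symm)
      rw [hMsub, wedge_neg_left, wedge_smul_right, wedge_swap]
      nlinarith
    · have hna : -a = c • d := by rw [hac, neg_neg]
      have hcδ : M + δ • d = M + (δ / c) • -a := by
        rw [hna, smul_smul, div_mul_cancel₀ _ hc.ne']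
      have hcslit : ∃ s ∈ Ioo 0 t, M + δ • d = M + s • -a := by
        refine ⟨δ / c, ⟨by positivity, ?_⟩, hcδ⟩
        by_contra! hcon
        refine (hnegd (t * c) ⟨by positivity, (le_div_iff₀ hc).1 hcon⟩).2 ?_
        rwa [hna, smul_smul] at hthit
      have h1 : l q = l (M + δ • d) := by
        refine hl G hGpre hGR (fun y hy => ?_) q hqG _ hcG
        rcases hGleft y hy with h | h
        · exact Or.inr (h ▸ hcslit)
        · rw [hna, wedge_smul_left]
          exact Or.inl (mul_pos hc h).ne'
      have h2 : l (M + δ • -b) = l (M + δ • d) := by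
        refine hl (segment ℝ (M + δ • -b) (M + δ • d)) (convex_segment _ _).isPreconnected ?_ ?_ _
          (left_mem_segment ℝ _ _) _ (right_mem_segment ℝ _ _)
        · intro y hy
          obtain ⟨r, s, hr, hs, hrs, rfl⟩ := mem_segment_add hy
          have hn := hcombo _ _ (hsmall δ hδδ).2.1 (hsmall δ hδδ).2.2 r s hr hs hrs
          rcases hs.eq_or_lt with rfl | hs
          · obtain rfl : r = 1 := by linarith
            simpa using hnb
          · refine (hright _ hn ?_).1
            rw [wedge_add_right, wedge_smul_right, wedge_smul_right, wedge_smul_right,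
              wedge_smul_right, wedge_neg_right, wedge_self]
            have := mul_pos hs (mul_pos hδ (neg_pos.2 hbd))
            linarith
        · intro y hy
          obtain ⟨r, s, hr, hs, hrs, rfl⟩ := mem_segment_add hy
          rcases hr.eq_or_lt with rfl | hr
          · obtain rfl : s = 1 := by linarith
            simpa using Or.inr hcslit
          · refine Or.inl (ne_of_lt ?_)
            rw [hMsub, hna, wedge_smul_left, wedge_add_right, wedge_smul_right, wedge_smul_right,
              wedge_smul_right, wedge_smul_right, wedge_neg_right, wedge_self]
            have := mul_pos hc (mul_pos hr (mul_pos hδ hdb))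
            linarith
      refine hopp _ _ ?_ hbside (h1.trans h2.symm)
      rw [hna, wedge_smul_left]
      exact mul_pos hc hdq
  refine ⟨C, ?_⟩
  rw [Cut.pocket, pocketOfSeg, hCseg, hCu]
  refine notMem_closure_of_slit hsub hpre hq hsegdisj hκ ⟨?_, ?_⟩ hne
  · exact hedge (right_mem_segment ℝ _ _)
  · have := haray 1 one_pos
    rwa [one_smul, ← hM'] at this

end SimplePolygon

/-! ### The vertex blocking a line of sight -/

lemma IsCompact.exists_forall_add_smul_mem {K U : Set E2} (hK : IsCompact K) (hU : IsOpen U)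
    (hKU : K ⊆ U) (e : E2) : ∃ η > 0, ∀ z ∈ K, ∀ s ∈ Icc (0 : ℝ) η, z + s • e ∈ U := by
  obtain ⟨ε, hε, h⟩ := hK.exists_thickening_subset_open hU hKU
  obtain ⟨η, hη, hηε⟩ := SimplePolygon.exists_pos_norm_smul_lt e hε
  refine ⟨η, hη, fun z hz s hs => h (Metric.mem_thickening_iff.2 ⟨z, hz, ?_⟩)⟩
  rw [dist_eq_norm, add_sub_cancel_left]
  exact hηε s (by rw [abs_of_nonneg hs.1]; exact hs.2)

namespace SimplePolygon

variable {P : SimplePolygon}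

lemma edge_subset_region {k j : ZMod P.n} (hj : j = k + 1 ∨ j = k - 1) :
    segment ℝ (P.vtx k) (P.vtx j) ⊆ P.region := by
  refine Subset.trans ?_ P.boundary_subset_region
  rcases hj with rfl | rfl
  · exact subset_iUnion (fun i : ZMod P.n => segment ℝ (P.vtx i) (P.vtx (i + 1))) k
  · have := subset_iUnion (fun i : ZMod P.n => segment ℝ (P.vtx i) (P.vtx (i + 1))) (k - 1)
    rwa [sub_add_cancel, segment_symm] at this

/-- Rotating a line of sight `[x, x + d]` towards `e`, if it gets blocked immediately, then some
cut has a pocket avoided by every connected set through `x + d + L • e` not visible from `x`. -/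
lemma exists_cut_of_blocked {σ : ℝ} (hσ : σ ≠ 0) {Pth : Set E2} (hsub : Pth ⊆ P.region)
    (hpre : IsPreconnected Pth) {x d e : E2} {L : ℝ} (hL : 0 < L) (hde : 0 < wedge σ d e)
    (hsight : ∀ r ∈ Icc (0 : ℝ) 1, x + r • d ∈ P.region) (hend : x + d ∉ P.boundary)
    (hshift : ∀ s ∈ Icc 0 L, x + d + s • e ∈ P.region)
    (hblock : ∀ s ∈ Ioc 0 L, ∃ r ∈ Icc (0 : ℝ) 1, x + r • (d + s • e) ∉ P.region)
    (hnvis : ∀ p ∈ Pth, ¬P.Visible x p) (hq : x + d + L • e ∈ Pth) :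
    ∃ C : P.Cut, Pth ∩ C.pocket = ∅ := by
  have hd : d ≠ 0 := by
    rintro rfl
    simp at hde
  set Bad : Set E2 := {z | 0 < wedge σ d (z - x)} \ P.region with hBad
  have hBadR : Bad ⊆ P.regionᶜ := fun z hz => hz.2
  have hwedge : ∀ (r : ℝ) (z : E2), wedge σ d (x + r • d + z - x) = wedge σ d z := by
    intro r z
    rw [show x + r • d + z - x = r • d + z by abel, wedge_add_right, wedge_smul_right, wedge_self,
      mul_zero, zero_add]
  have hgood : ∀ (r : ℝ) (z : E2), 0 < wedge σ d z → x + r • d + z ∉ closure Bad →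
      x + r • d + z ∈ P.region := by
    intro r z hz hcl
    by_contra hcon
    exact hcl (subset_closure ⟨by rw [mem_ofPred, hwedge]; exact hz, hcon⟩)
  obtain ⟨δ, hδ, hδ1, hblock'⟩ : ∃ δ : ℝ, 0 < δ ∧ δ ≤ 1 ∧
      ∀ s ∈ Ioc 0 (min L 1), ∃ r ∈ Icc δ 1, x + r • (d + s • e) ∉ P.region := by
    obtain ⟨ε, hε, hcon⟩ := P.exists_conic x
    refine ⟨min 1 (ε / (2 * (‖d‖ + ‖e‖ + 1))), by positivity, min_le_left _ _, fun s hs => ?_⟩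
    set δ := min 1 (ε / (2 * (‖d‖ + ‖e‖ + 1)))
    have hδ : 0 < δ := by positivity
    obtain ⟨r, hr, hrR⟩ := hblock s ⟨hs.1, hs.2.trans (min_le_left _ _)⟩
    rcases le_or_gt δ r with h | h
    · exact ⟨r, ⟨h, hr.2⟩, hrR⟩
    · refine ⟨δ, ⟨le_rfl, min_le_left _ _⟩, fun hδR => hrR ?_⟩
      have hr0 : 0 < r := hr.1.lt_of_ne (by
        rintro rfl
        simpa using hrR (by simpa using hsight 0 (by simp)))
      have hnorm : ‖δ • (d + s • e)‖ < ε := by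
        rw [norm_smul, Real.norm_of_nonneg hδ.le]
        have h1 : ‖d + s • e‖ ≤ ‖d‖ + ‖e‖ + 1 := by
          refine (norm_add_le _ _).trans ?_
          rw [norm_smul, Real.norm_of_nonneg hs.1.le]
          nlinarith [norm_nonneg e, hs.2.trans (min_le_right L 1)]
        calc δ * ‖d + s • e‖ ≤ ε / (2 * (‖d‖ + ‖e‖ + 1)) * (‖d‖ + ‖e‖ + 1) := by
              gcongr
              exact min_le_right _ _
          _ = ε / 2 := by field_simp
          _ < ε := by linarith
      have := ((hcon _ hnorm (r / δ) ⟨by positivity, (div_le_one hδ).2 h.le⟩).2).1 hδR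
      rwa [smul_smul, div_mul_cancel₀ _ hδ.ne'] at this
  have hcont : Continuous fun r : ℝ => x + r • d := by fun_prop
  set F : Set ℝ := Icc δ 1 ∩ (fun r : ℝ => x + r • d) ⁻¹' closure Bad with hF
  have hFc : IsCompact F := isCompact_Icc.inter_right (isClosed_closure.preimage hcont)
  have hFne : F.Nonempty := by
    by_contra hcon
    rw [not_nonempty_iff_eq_empty] at hcon
    obtain ⟨η, hη, h⟩ := (isCompact_Icc.image (s := Icc δ 1) hcont).exists_forall_add_smul_mem
      (isClosed_closure (s := Bad)).isOpen_compl (by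
        rintro _ ⟨r, hr, rfl⟩ hmem
        exact notMem_empty r (hcon ▸ ⟨hr, hmem⟩)) e
    obtain ⟨s, hs, hsη, hsL⟩ : ∃ s : ℝ, 0 < s ∧ s ≤ η ∧ s ≤ min L 1 :=
      ⟨min η (min L 1), by positivity, min_le_left _ _, min_le_right _ _⟩
    obtain ⟨r, hr, hrR⟩ := hblock' s ⟨hs, hsL⟩
    have hr0 : 0 < r := hδ.trans_le hr.1
    have heq : x + r • (d + s • e) = x + r • d + (r * s) • e := by module
    rw [heq] at hrR
    refine hrR (hgood r _ ?_ (h _ (mem_image_of_mem _ hr) (r * s) ⟨by positivity, ?_⟩))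
    · rw [wedge_smul_right]
      positivity
    · nlinarith [hr.2]
  obtain ⟨α, ⟨hα, hαcl⟩, hαmax⟩ := hFc.exists_isGreatest hFne
  have hα0 : 0 < α := hδ.trans_le hα.1
  have hafter : ∀ r, α < r → r ≤ 1 → x + r • d ∉ closure Bad := fun r hr hr1 hcl =>
    absurd (hαmax ⟨⟨hα.1.trans hr.le, hr1⟩, hcl⟩) (not_le.2 hr)
  have hMcl : x + α • d ∈ closure P.regionᶜ := closure_mono hBadR hαcl
  have hMb : x + α • d ∈ P.boundary :=
    P.mem_boundary_of_mem_closure_compl (hsight α ⟨hα0.le, hα.2⟩) hMcl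
  have hα1 : α < 1 := hα.2.lt_of_ne (by
    rintro rfl
    exact hend (by simpa using hMb))
  have hM_add : ∀ s : ℝ, x + α • d + s • d = x + (α + s) • d := fun s => by module
  obtain ⟨a, b, hrays, hvtx⟩ := P.exists_isLocalRays hMb
  set δ₂ := min α (1 - α) with hδ₂def
  have hδ₂ : 0 < δ₂ := lt_min hα0 (by linarith)
  have hδ₂α : δ₂ ≤ α := min_le_left _ _
  have hδ₂α' : δ₂ ≤ 1 - α := min_le_right _ _
  obtain ⟨a', b', hswap, hdb, hab, hda, ε, hε, hcone⟩ := hrays.exists_isExteriorCone hσ hd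
    (fun ε hε => by
      obtain ⟨z, hz, hdist⟩ := Metric.mem_closure_iff.1 hαcl ε hε
      refine ⟨z - (x + α • d), by rwa [← norm_neg, neg_sub, ← dist_eq_norm], ?_, ?_⟩
      · rw [← hwedge α, add_sub_cancel]
        exact hz.1
      · rw [add_sub_cancel]
        exact hz.2) hδ₂
    (fun s hs => by
      have := abs_le.1 hs
      rw [hM_add]
      exact hsight _ ⟨by linarith, by linarith⟩)
    (fun s hs => by
      rw [hM_add]
      obtain ⟨η, hη, hball⟩ := Metric.isOpen_iff.1 (isClosed_closure (s := Bad)).isOpen_compl _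
        (hafter (α + s) (by linarith [hs.1]) (by linarith [hs.2]))
      exact ⟨η, hη, fun z hz hdz => hgood _ z hdz (hball (by simpa using hz))⟩)
  obtain ⟨k, j, hk, hj, ha', hreflex⟩ : ∃ k j, P.vtx k = x + α • d ∧ (j = k + 1 ∨ j = k - 1) ∧
      a' = P.vtx j - P.vtx k ∧ P.IsReflex k := by
    rcases hvtx with rfl | ⟨k, hk, ha, hb⟩
    · rcases hswap with ⟨rfl, rfl⟩ | ⟨rfl, rfl⟩ <;>
        simp [wedge_neg_right, wedge_neg_left] at hab
    have hreflex : P.IsReflex k := by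
      obtain ⟨ε', hε', hn⟩ := exists_pos_norm_smul_lt (a' + b') hε
      refine ⟨ε', hε', fun s hs => ?_⟩
      have hmid : midpoint ℝ (P.vtx k + s • (P.vtx (k - 1) - P.vtx k))
          (P.vtx k + s • (P.vtx (k + 1) - P.vtx k)) = x + α • d + (s / 2) • (a' + b') := by
        have hsum : a' + b' = a + b := by
          rcases hswap with ⟨rfl, rfl⟩ | ⟨rfl, rfl⟩
          exacts [rfl, add_comm _ _]
        rw [hsum, ha, hb, ← hk, midpoint_eq_smul_add, invOf_eq_inv]
        module
      rw [hmid]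
      have hs2 : 0 < s / 2 := half_pos hs.1
      refine hcone.2.2 _ (hn _ ?_) ?_ ?_
      · rw [abs_of_pos hs2]
        linarith [hs.2, hs.1]
      · rw [wedge_smul_right, wedge_add_right, wedge_self]
        nlinarith
      · rw [wedge_smul_right, wedge_add_right, wedge_self, wedge_swap]
        nlinarith
    rcases hswap with ⟨rfl, rfl⟩ | ⟨rfl, rfl⟩
    · exact ⟨k, k + 1, hk, Or.inl rfl, by rw [ha, hk], hreflex⟩
    · exact ⟨k, k - 1, hk, Or.inr rfl, by rw [hb, hk], hreflex⟩
  subst ha'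
  rw [← hk] at hMcl hcone
  refine exists_cut_pocket_disjoint hσ hsub hpre hα0.le hd hk
    (fun r hr => hsight r ⟨hr.1, hr.2.trans hα.2⟩) hnvis hq ?_ hj hreflex hMcl hdb hab hda hε hcone
    (edge_subset_region hj) hδ₂ ?_
  · rw [hk, show x + d + L • e - (x + α • d) = (1 - α) • d + L • e by module, wedge_add_right,
      wedge_smul_right, wedge_self, wedge_smul_right]
    have := mul_pos hL hde
    linarith
  · intro s hs
    rw [hk, hM_add]
    have hαs : α < α + s := by linarith [hs.1]
    have hαs1 : α + s ≤ 1 := by linarith [hs.2]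
    obtain ⟨η', hη', h'⟩ := (isCompact_Icc.image (s := Icc (α + s) 1)
      hcont).exists_forall_add_smul_mem (isClosed_closure (s := Bad)).isOpen_compl (by
        rintro _ ⟨r, hr, rfl⟩
        exact hafter r (hαs.trans_le hr.1) hr.2) e
    obtain ⟨η, hη, hηη', hηL⟩ : ∃ η : ℝ, 0 < η ∧ η ≤ η' ∧ η ≤ L :=
      ⟨min η' L, by positivity, min_le_left _ _, min_le_right _ _⟩
    have hR : ∀ r ∈ Icc (α + s) 1, ∀ c ∈ Icc 0 η, x + r • d + c • e ∈ P.region := by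
      intro r hr c hc
      rcases hc.1.eq_or_lt with rfl | hc0
      · simpa using hsight r ⟨by linarith [hr.1], hr.2⟩
      · refine hgood r _ ?_ (h' _ (mem_image_of_mem _ hr) c ⟨hc.1, hc.2.trans hηη'⟩)
        rw [wedge_smul_right]
        positivity
    have hside : ∀ r c : ℝ, 0 < c → 0 < wedge σ d (x + r • d + c • e - (x + α • d)) := by
      intro r c hc
      rw [show x + r • d + c • e - (x + α • d) = (r - α) • d + c • e by module, wedge_add_right,
        wedge_smul_right, wedge_self, wedge_smul_right]
      have := mul_pos hc hde
      linarith
    have h1s : x + d = x + (1 : ℝ) • d := by rw [one_smul]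
    refine ⟨(fun c : ℝ => x + (α + s) • d + c • e) '' Icc 0 η ∪
      (fun r : ℝ => x + r • d + η • e) '' Icc (α + s) 1 ∪
      (fun c : ℝ => x + (1 : ℝ) • d + c • e) '' Icc η L, ?_, ?_, ?_, ?_, ?_⟩
    · refine IsPreconnected.union (x + (1 : ℝ) • d + η • e) (Or.inr ⟨1, ⟨hαs1, le_rfl⟩, rfl⟩)
        ⟨η, ⟨le_rfl, hηL⟩, rfl⟩ (IsPreconnected.union (x + (α + s) • d + η • e)
          ⟨η, ⟨hη.le, le_rfl⟩, rfl⟩ ⟨α + s, ⟨le_rfl, hαs1⟩, rfl⟩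
          (isPreconnected_Icc.image _ (by fun_prop)) (isPreconnected_Icc.image _ (by fun_prop)))
        (isPreconnected_Icc.image _ (by fun_prop))
    · rintro _ ((⟨c, hc, rfl⟩ | ⟨r, hr, rfl⟩) | ⟨c, hc, rfl⟩)
      · exact hR _ ⟨le_rfl, hαs1⟩ c hc
      · exact hR r hr η ⟨hη.le, le_rfl⟩
      · have := hshift c ⟨hη.le.trans hc.1, hc.2⟩
        rwa [h1s] at this
    · exact Or.inl (Or.inl ⟨0, ⟨le_rfl, hη.le⟩, by simp⟩)
    · exact Or.inr ⟨L, ⟨hηL, le_rfl⟩, by simp⟩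
    · rintro _ ((⟨c, hc, rfl⟩ | ⟨r, hr, rfl⟩) | ⟨c, hc, rfl⟩)
      · rcases hc.1.eq_or_lt with rfl | hc0
        · simp
        · exact Or.inr (hside _ c hc0)
      · exact Or.inr (hside r η hη)
      · exact Or.inr (hside 1 c (hη.trans_le hc.1))

end SimplePolygon

namespace SimplePolygon

variable {P : SimplePolygon}

lemma visible_iff_forall_add_smul_mem {x y : E2} :
    P.Visible x y ↔ ∀ r ∈ Icc (0 : ℝ) 1, x + r • (y - x) ∈ P.region := by
  simp only [Visible, segment_eq_image', image_subset_iff]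
  rfl

lemma Visible.mono_right {x y z : E2} (h : P.Visible x y) (hz : z ∈ segment ℝ x y) :
    P.Visible x z :=
  ((convex_segment (𝕜 := ℝ) x y).segment_subset (left_mem_segment ℝ _ _) hz).trans h

lemma isClosed_setOf_visible_add_smul (x p e : E2) :
    IsClosed {t : ℝ | P.Visible x (p + t • e)} := by
  simp only [visible_iff_forall_add_smul_mem, ofPred_forall]
  exact isClosed_biInter fun r _ => P.isClosed_region.preimage (by fun_prop)

namespace Cut

variable (C : P.Cut)

lemma mem_seg_iff {z : E2} :
    z ∈ C.seg ↔ ∃ s ∈ Icc 0 C.t, z = C.v + s • (C.v - C.u) := by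
  constructor
  · exact fun h => mem_segment_add_smul C.t_pos.le h
  · rintro ⟨s, hs, rfl⟩
    have := C.t_pos
    rw [seg, segment_eq_image']
    refine ⟨s / C.t, ⟨div_nonneg hs.1 this.le, (div_le_one this).2 hs.2⟩, ?_⟩
    simp only [w, v, u]
    rw [add_sub_cancel_left, smul_smul, div_mul_cancel₀ _ this.ne']

lemma notMem_boundary_of_mem_seg {z : E2} (hz : z ∈ C.seg) (hv : z ≠ C.v) (hw : z ≠ C.w) :
    z ∉ P.boundary := by
  obtain ⟨s, hs, rfl⟩ := C.mem_seg_iff.1 hz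
  refine C.first_hit s ⟨hs.1.lt_of_ne ?_, hs.2.lt_of_ne ?_⟩
  · rintro rfl
    simp at hv
  · rintro rfl
    exact hw rfl

/-- A point on the line through a cut seeing a point of the cut sees an endpoint of it. -/
lemma visible_left_or_right {x y : E2} {s : ℝ} (hx : x = C.v + s • (C.v - C.u))
    (hy : y ∈ C.seg) (hxy : P.Visible x y) : P.Visible x C.v ∨ P.Visible x C.w := by
  obtain ⟨r, hr, rfl⟩ := C.mem_seg_iff.1 hy
  rcases lt_or_ge s 0 with h | h
  · refine Or.inl (hxy.mono_right ?_)
    rw [segment_eq_image']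
    have hrs : 0 < r - s := by linarith [hr.1]
    refine ⟨-s / (r - s), ⟨div_nonneg (by linarith) hrs.le,
      (div_le_one hrs).2 (by linarith [hr.1])⟩, ?_⟩
    simp only [hx, add_sub_add_left_eq_sub, ← sub_smul, smul_smul, div_mul_cancel₀ _ hrs.ne']
    module
  rcases le_or_gt s C.t with h' | h'
  · exact Or.inl (((convex_segment (𝕜 := ℝ) C.v C.w).segment_subset
      (C.mem_seg_iff.2 ⟨s, ⟨h, h'⟩, hx⟩) (left_mem_segment ℝ _ _)).trans C.inside)
  · refine Or.inr (hxy.mono_right ?_)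
    rw [segment_eq_image']
    have hrs : 0 < s - r := by linarith [hr.2]
    refine ⟨(s - C.t) / (s - r), ⟨div_nonneg (by linarith) hrs.le,
      (div_le_one hrs).2 (by linarith [hr.2])⟩, ?_⟩
    have : C.v + r • (C.v - C.u) - x = -((s - r) • (C.v - C.u)) := by rw [hx]; module
    simp only [this]
    rw [smul_neg, smul_smul, div_mul_cancel₀ _ hrs.ne', hx]
    simp only [w, v, u]
    module

lemma exists_cut_of_not_visible {Pth : Set E2} (hsub : Pth ⊆ P.region)
    (hpre : IsPreconnected Pth) {x q : E2} (hseen : ∃ p ∈ C.seg, P.Visible x p)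
    (hnv : ¬P.Visible x C.v) (hnw : ¬P.Visible x C.w) (hnvis : ∀ p ∈ Pth, ¬P.Visible x p)
    (hq : q ∈ Pth) (hqC : q ∈ C.seg) : ∃ C' : P.Cut, Pth ∩ C'.pocket = ∅ := by
  obtain ⟨p, hpC, hxp⟩ := hseen
  obtain ⟨T, ⟨hT, hxT⟩, hTmax⟩ := (isCompact_Icc.inter_right
    (isClosed_setOf_visible_add_smul (P := P) x p (q - p))).exists_isGreatest
      (⟨0, left_mem_Icc.2 zero_le_one, by simpa using hxp⟩ :
        (Icc (0 : ℝ) 1 ∩ {t : ℝ | P.Visible x (p + t • (q - p))}).Nonempty)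
  have hpq : ∀ t ∈ Icc (0 : ℝ) 1, p + t • (q - p) ∈ C.seg := fun t ht =>
    (convex_segment (𝕜 := ℝ) C.v C.w).segment_subset hpC hqC
      (by rw [segment_eq_image']; exact ⟨t, ht, rfl⟩)
  have hT1 : T < 1 := hT.2.lt_of_ne (by
    rintro rfl
    exact hnvis q hq (by simpa using hxT))
  have hcross : cross2 (p + T • (q - p) - x) (q - p) ≠ 0 := by
    intro h0
    have hne : q - p ≠ 0 := fun h => hnvis q hq (by rwa [sub_eq_zero.1 h])
    obtain ⟨μ, hμ⟩ := exists_smul_eq_of_cross2_eq_zero (a := q - p)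
      (b := p + T • (q - p) - x) hne (by rw [cross2] at h0 ⊢; linarith)
    obtain ⟨a, -, ha⟩ := C.mem_seg_iff.1 hpC
    obtain ⟨b, -, hb⟩ := C.mem_seg_iff.1 hqC
    have hx : x = C.v + (a + (T - μ) * (b - a)) • (C.v - C.u) := by
      have hx' : x = p + (T - μ) • (q - p) := by
        rw [← sub_sub_cancel (p + T • (q - p)) x, hμ]
        module
      rw [hx', hb, ha]
      module
    rcases C.visible_left_or_right hx (hpq T hT) hxT with h | h
    exacts [hnv h, hnw h]
  refine exists_cut_of_blocked (x := x) (d := p + T • (q - p) - x) (e := q - p) (L := 1 - T)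
    hcross hsub hpre (by linarith) (mul_self_pos.2 hcross)
    (visible_iff_forall_add_smul_mem.1 hxT) ?_ ?_ ?_ hnvis ?_
  · rw [add_sub_cancel]
    refine C.notMem_boundary_of_mem_seg (hpq T hT) ?_ ?_ <;> intro h
    exacts [hnv (h ▸ hxT), hnw (h ▸ hxT)]
  · intro s hs
    rw [add_sub_cancel, add_assoc, ← add_smul]
    exact C.inside (hpq _ ⟨by linarith [hs.1, hT.1], by linarith [hs.2]⟩)
  · intro s hs
    have hT' : ¬P.Visible x (p + (T + s) • (q - p)) := fun h => by
      linarith [hs.1, hTmax ⟨⟨by linarith [hs.1, hT.1], by linarith [hs.2]⟩, h⟩]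
    rw [visible_iff_forall_add_smul_mem] at hT'
    push Not at hT'
    obtain ⟨r, hr, hrR⟩ := hT'
    refine ⟨r, hr, ?_⟩
    rwa [show p + T • (q - p) - x + s • (q - p) = p + (T + s) • (q - p) - x by module]
  · rw [add_sub_cancel, add_assoc, ← add_smul, add_sub_cancel, one_smul, add_sub_cancel]
    exact hq

end Cut

end SimplePolygon

/-- With the funnel data of a vertex `x` of `Pocket(C)` visible from
part of the nonredundant cut `C`, if a connected curve `Pth` intersecting every
nonredundant cut meets the subsegment of `C` from `I_{L_x}` to `I_{R_x}`, or the one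
from `v_C` to `I_{L_x}`, or the one from `I_{R_x}` to `w_C`, then `x` is visible from
some point of `Pth`. -/
theorem funnel_cases_imply_visible
    (P : SimplePolygon) (Pth : Set E2) (hsub : Pth ⊆ P.region) (hconn : IsConnected Pth)
    (hcuts : ∀ C : P.Cut, C.Nonredundant → (Pth ∩ C.seg).Nonempty)
    (C : P.Cut) (hC : C.Nonredundant)
    (x : E2) (hx : C.PocketVertex x)
    (hseen : ∃ p ∈ C.seg, P.Visible x p)
    (hnv : ¬ P.Visible x C.v) (hnw : ¬ P.Visible x C.w)
    (Lx Rx : E2)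
    (la : List E2) (hla : P.IsGeodesicTo x {C.v} la) (hLx : la.tail.head? = some Lx)
    (lb : List E2) (hlb : P.IsGeodesicTo x {C.w} lb) (hRx : lb.tail.head? = some Rx)
    (ILx IRx : E2)
    (hIL : ILx ∈ C.seg ∧ ∃ t : ℝ, 1 < t ∧ ILx = x + t • (Lx - x))
    (hIR : IRx ∈ C.seg ∧ ∃ t : ℝ, 1 < t ∧ IRx = x + t • (Rx - x))
    (CL : P.Cut) (hCLv : CL.v = Lx)
    (hCLgen : ∃ l' : List E2, P.IsGeodesicTo CL.u {C.v} l' ∧ l'.tail.head? = some Lx)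
    (CR : P.Cut) (hCRv : CR.v = Rx)
    (hCRgen : ∃ l' : List E2, P.IsGeodesicTo CR.u {C.w} l' ∧ l'.tail.head? = some Rx)
    (hcase : (Pth ∩ segment ℝ ILx IRx).Nonempty ∨
             (Pth ∩ segment ℝ C.v ILx).Nonempty ∨
             (Pth ∩ segment ℝ IRx C.w).Nonempty) :
    ∃ p ∈ Pth, P.Visible x p := by
  by_contra! hnvis
  have hseg : ∀ {a b : E2}, a ∈ C.seg → b ∈ C.seg → segment ℝ a b ⊆ C.seg := fun ha hb =>
    (convex_segment (𝕜 := ℝ) C.v C.w).segment_subset ha hb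
  have hvC : C.v ∈ C.seg := left_mem_segment ℝ _ _
  have hwC : C.w ∈ C.seg := right_mem_segment ℝ _ _
  obtain ⟨q, hqP, hqC⟩ : ∃ q ∈ Pth, q ∈ C.seg := by
    rcases hcase with ⟨q, hq, h⟩ | ⟨q, hq, h⟩ | ⟨q, hq, h⟩
    · exact ⟨q, hq, hseg hIL.1 hIR.1 h⟩
    · exact ⟨q, hq, hseg hvC hIL.1 h⟩
    · exact ⟨q, hq, hseg hIR.1 hwC h⟩
  obtain ⟨C', hC'⟩ := C.exists_cut_of_not_visible hsub hconn.isPreconnected hseen hnv hnw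
    hnvis hqP hqC
  exact (C'.inter_pocket_nonempty hcuts).ne_empty hC'
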